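/- arXiv:2102.05352 — 7 statements merged into one kernel-verified Lean document; each statement's English description precedes it below -/
import Mathlib

section
/- Let a₁ and a₂ be distinct positive integers and set A = {a₁, a₂}. Then for every nonconstant polynomial f with integer coefficients and positive leading coefficient, there exist infinitely many pairs (x, y) of positive integers such that P_A(x) = f(y). -/
/-- `partCount A n` is the number of partitions of `n` into parts from `A`. -/
def partCount (A : Finset ℕ) (n : ℕ) : ℕ :=
  ((Finset.univ : Finset (Nat.Partition n)).filter (fun p => ∀ i ∈ p.parts, i ∈ A)).card

theorem Multiset.eq_replicate_add_replicate {α : Type*} [DecidableEq α] {a b : α} (hab : a ≠ b)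
    {s : Multiset α} (hs : ∀ i ∈ s, i = a ∨ i = b) :
    s = Multiset.replicate (s.count a) a + Multiset.replicate (s.count b) b := by
  ext x
  rw [Multiset.count_add, Multiset.count_replicate, Multiset.count_replicate]
  by_cases hxa : a = x
  · subst hxa
    simp [hab.symm]
  · by_cases hxb : b = x
    · subst hxb
      simp [hab]
    · have hx : x ∉ s := fun h => (hs x h).elim (fun e => hxa e.symm) (fun e => hxb e.symm)
      simp [hxa, hxb, Multiset.count_eq_zero_of_notMem hx]

/-- The partition of `d * b * c * k` into `c * t` parts `d * b` and `b * (k - t)` parts `d * c`. -/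
def twoPartPartition {b c d : ℕ} (hb : 0 < b) (hc : 0 < c) (hd : 0 < d) {k t : ℕ} (ht : t ≤ k) :
    Nat.Partition (d * b * c * k) where
  parts := Multiset.replicate (c * t) (d * b) + Multiset.replicate (b * (k - t)) (d * c)
  parts_pos := by
    intro i hi
    rcases Multiset.mem_add.1 hi with h | h <;> rw [Multiset.eq_of_mem_replicate h] <;> positivity
  parts_sum := by
    obtain ⟨s, rfl⟩ := Nat.exists_eq_add_of_le ht
    simp only [Multiset.sum_add, Multiset.sum_replicate, smul_eq_mul, Nat.add_sub_cancel_left]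
    ring

theorem partCount_pair_mul {b c d : ℕ} (hb : 0 < b) (hc : 0 < c) (hd : 0 < d)
    (hbc : Nat.Coprime b c) (hne : d * b ≠ d * c) (k : ℕ) :
    partCount {d * b, d * c} (d * b * c * k) = k + 1 := by
  rw [← Finset.card_range (k + 1)]
  symm
  refine Finset.card_bij
    (fun t ht => twoPartPartition hb hc hd (Nat.lt_succ_iff.1 (Finset.mem_range.1 ht))) ?_ ?_ ?_
  · intro t ht
    simp only [Finset.mem_filter, Finset.mem_univ, true_and, Finset.mem_insert,
      Finset.mem_singleton]
    intro i hi
    exact (Multiset.mem_add.1 hi).imp Multiset.eq_of_mem_replicate Multiset.eq_of_mem_replicate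
  · intro t ht s hs h
    have h' := congrArg (fun p : Nat.Partition (d * b * c * k) => p.parts.count (d * b)) h
    simp only [twoPartPartition, Multiset.count_add, Multiset.count_replicate, if_neg hne.symm,
      if_true, add_zero] at h'
    exact Nat.eq_of_mul_eq_mul_left hc h'
  · intro p hp
    simp only [Finset.mem_filter, Finset.mem_univ, true_and, Finset.mem_insert,
      Finset.mem_singleton] at hp
    have hparts := Multiset.eq_replicate_add_replicate hne hp
    have hsum := p.parts_sum
    rw [hparts] at hsum
    simp only [Multiset.sum_add, Multiset.sum_replicate, smul_eq_mul] at hsum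
    generalize p.parts.count (d * b) = u at hparts hsum
    generalize p.parts.count (d * c) = v at hparts hsum
    have huv : b * u + c * v = b * c * k := by
      apply Nat.eq_of_mul_eq_mul_left hd
      linarith
    have hcu : c ∣ u := by
      refine hbc.symm.dvd_of_dvd_mul_left ((Nat.dvd_add_left (dvd_mul_right c v)).1 ?_)
      exact huv ▸ ⟨b * k, by ring⟩
    obtain ⟨t, rfl⟩ := hcu
    have hv : b * t + v = b * k := by
      apply Nat.eq_of_mul_eq_mul_left hc
      linarith
    have ht : t ≤ k := Nat.le_of_mul_le_mul_left (by omega) hb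
    refine ⟨t, Finset.mem_range.2 (Nat.lt_succ_of_le ht), ?_⟩
    apply Nat.Partition.ext
    rw [hparts, show v = b * (k - t) by rw [Nat.mul_sub]; omega]
    rfl

theorem Polynomial.tendsto_eval_natCast_atTop {f : Polynomial ℤ} (hdeg : f.natDegree ≠ 0)
    (hlead : 0 < f.leadingCoeff) :
    Filter.Tendsto (fun n : ℕ => f.eval (n : ℤ)) Filter.atTop Filter.atTop := by
  have hinj : Function.Injective (Int.castRingHom ℝ) := Int.cast_injective
  have h := Polynomial.tendsto_atTop_of_leadingCoeff_nonneg (f.map (Int.castRingHom ℝ))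
    (by
      rw [Polynomial.degree_map_eq_of_injective hinj]
      exact Polynomial.natDegree_pos_iff_degree_pos.1 (Nat.pos_of_ne_zero hdeg))
    (by
      rw [Polynomial.leadingCoeff_map_of_injective hinj]
      simpa using hlead.le)
  rw [← tendsto_intCast_atTop_iff (R := ℝ)]
  refine (h.comp tendsto_natCast_atTop_atTop).congr fun n => ?_
  simp

theorem stmt0 (a₁ a₂ : ℕ) (ha₁ : 0 < a₁) (ha₂ : 0 < a₂) (hne : a₁ ≠ a₂)
    (f : Polynomial ℤ) (hdeg : f.natDegree ≠ 0) (hlead : 0 < f.leadingCoeff) :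
    {xy : ℕ × ℕ | 0 < xy.1 ∧ 0 < xy.2 ∧
      (partCount {a₁, a₂} xy.1 : ℤ) = f.eval (xy.2 : ℤ)}.Infinite := by
  have hd : 0 < Nat.gcd a₁ a₂ := Nat.gcd_pos_of_pos_left _ ha₁
  obtain ⟨b, c, hbc, hb, hc⟩ := Nat.exists_coprime a₁ a₂
  generalize Nat.gcd a₁ a₂ = d at hd hb hc
  rw [mul_comm] at hb hc
  subst hb hc
  have hb : 0 < b := Nat.pos_of_mul_pos_left ha₁
  have hc : 0 < c := Nat.pos_of_mul_pos_left ha₂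
  obtain ⟨N, hN⟩ := Filter.eventually_atTop.1
    ((Polynomial.tendsto_eval_natCast_atTop hdeg hlead).eventually_ge_atTop 2)
  refine Set.infinite_of_injective_forall_mem (f := fun m : ℕ =>
    (d * b * c * (f.eval ((N + m + 1 : ℕ) : ℤ) - 1).toNat, N + m + 1)) ?_ ?_
  · intro m n h
    have := congrArg Prod.snd h
    simp only at this
    omega
  · intro m
    have h2 := hN (N + m + 1) (by omega)
    refine ⟨?_, Nat.succ_pos _, ?_⟩
    · have : 0 < (f.eval ((N + m + 1 : ℕ) : ℤ) - 1).toNat := by omega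
      positivity
    · simp only [partCount_pair_mul hb hc hd hbc hne]
      omega
end

section
/- Let a₁ and a₂ be distinct coprime positive integers. Then for every natural number t one has P_{{a₁,a₂}}(a₁·a₂·t) = t + 1. -/
/-- The solutions in natural numbers of `a * x + b * y = a * b * t` for coprime `a` and `b`. -/
theorem Nat.Coprime.exists_eq_mul_of_mul_add_mul_eq {a b t x y : ℕ} (ha : 0 < a) (hb : 0 < b)
    (hab : Nat.Coprime a b) (h : a * x + b * y = a * b * t) :
    ∃ k ≤ t, x = b * k ∧ y = a * (t - k) := by
  have hx : b ∣ a * x :=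
    (Nat.dvd_add_left (Dvd.intro y rfl)).1 (h ▸ ⟨a * t, by ring⟩)
  obtain ⟨k, rfl⟩ := hab.symm.dvd_of_dvd_mul_left hx
  have hy : a * k + y = a * t := Nat.eq_of_mul_eq_mul_left hb (by linarith)
  have hk : k ≤ t := Nat.le_of_mul_le_mul_left (by omega : a * k ≤ a * t) ha
  exact ⟨k, hk, rfl, by rw [Nat.mul_sub]; omega⟩

/-- The partition of `a * b * t` into `b * k` parts `a` and `a * (t - k)` parts `b`. -/
def Nat.Partition.ofTwoParts {a b t k : ℕ} (ha : 0 < a) (hb : 0 < b) (hk : k ≤ t) :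
    Nat.Partition (a * b * t) where
  parts := Multiset.replicate (b * k) a + Multiset.replicate (a * (t - k)) b
  parts_pos := by
    intro i hi
    rcases Multiset.mem_add.1 hi with hi | hi
    · exact Multiset.eq_of_mem_replicate hi ▸ ha
    · exact Multiset.eq_of_mem_replicate hi ▸ hb
  parts_sum := by
    obtain ⟨d, rfl⟩ := Nat.exists_eq_add_of_le hk
    simp only [Multiset.sum_add, Multiset.sum_replicate, smul_eq_mul, Nat.add_sub_cancel_left]
    ring

theorem stmt1 (a₁ a₂ : ℕ) (ha₁ : 0 < a₁) (ha₂ : 0 < a₂) (hne : a₁ ≠ a₂)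
    (hcop : Nat.Coprime a₁ a₂) (t : ℕ) :
    partCount {a₁, a₂} (a₁ * a₂ * t) = t + 1 := by
  rw [partCount, ← Finset.card_range (t + 1)]
  symm
  refine Finset.card_bij
    (fun k hk => Nat.Partition.ofTwoParts ha₁ ha₂ (Finset.mem_range_succ_iff.1 hk)) ?_ ?_ ?_
  · intro k hk
    refine Finset.mem_filter.2 ⟨Finset.mem_univ _, fun i hi => ?_⟩
    rcases Multiset.mem_add.1 hi with hi | hi
    · simp [Multiset.eq_of_mem_replicate hi]
    · simp [Multiset.eq_of_mem_replicate hi]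
  · intro k hk l hl h
    have hcount := congrArg (fun p => p.parts.count a₁) h
    simp only [Nat.Partition.ofTwoParts, Multiset.count_add, Multiset.count_replicate,
      hne.symm, if_true, if_false, add_zero] at hcount
    exact Nat.eq_of_mul_eq_mul_left ha₂ hcount
  · intro p hp
    have hparts := Multiset.eq_replicate_add_replicate hne (s := p.parts)
      (fun i hi => by simpa using (Finset.mem_filter.1 hp).2 i hi)
    have hsum := p.parts_sum
    rw [hparts, Multiset.sum_add, Multiset.sum_replicate, Multiset.sum_replicate, smul_eq_mul,
      smul_eq_mul, mul_comm (p.parts.count a₁) a₁, mul_comm (p.parts.count a₂) a₂] at hsum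
    obtain ⟨k, hk, hx, hy⟩ := hcop.exists_eq_mul_of_mul_add_mul_eq ha₁ ha₂ hsum
    refine ⟨k, Finset.mem_range_succ_iff.2 hk, Nat.Partition.ext ?_⟩
    rw [hparts, hx, hy]
    rfl
end

section
/- For every natural number n the following identities hold: 2·P₄(6n+1) = (n+1)(3n²+6n+2), 2·P₄(6n+3) = 3(n+1)²(n+2), 2·P₄(6n+5) = 3(n+1)(n+2)², P₄(12n) = 12n³+15n²+6n+1, P₄(12n+2) = 12n³+21n²+12n+2, P₄(12n+4) = (n+1)(12n²+15n+5), P₄(12n+6) = 3(n+1)²(4n+3), P₄(12n+8) = 3(n+1)²(4n+5), and P₄(12n+10) = (n+1)(12n²+33n+23). -/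
/-- Classifying partitions by whether the part `a` occurs. -/
theorem partCount_insert_add {A : Finset ℕ} {a : ℕ} (ha : 0 < a) (haA : a ∉ A) (n : ℕ) :
    partCount (insert a A) (n + a) = partCount (insert a A) n + partCount A (n + a) := by
  classical
  unfold partCount
  rw [← Finset.card_filter_add_card_filter_not (fun p : Nat.Partition (n + a) => a ∈ p.parts)]
  congr 1
  · symm
    refine Finset.card_bij (fun q _ => ⟨a ::ₘ q.parts, ?_, ?_⟩) ?_ ?_ ?_
    · intro i hi
      rcases Multiset.mem_cons.1 hi with rfl | hi
      · exact ha
      · exact q.parts_pos hi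
    · rw [Multiset.sum_cons, q.parts_sum, add_comm]
    · intro q hq
      simpa using hq
    · intro p _ q _ h
      simpa [Nat.Partition.ext_iff] using h
    · intro p hp
      simp only [Finset.mem_filter, Finset.mem_univ, true_and] at hp
      obtain ⟨hp, hap⟩ := hp
      obtain ⟨s, hs⟩ := Multiset.exists_cons_of_mem hap
      refine ⟨⟨s, fun {i} hi => p.parts_pos (hs ▸ Multiset.mem_cons_of_mem hi), ?_⟩, ?_, ?_⟩
      · have := p.parts_sum
        rw [hs, Multiset.sum_cons] at this
        omega
      · simp only [Finset.mem_filter, Finset.mem_univ, true_and]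
        exact fun i hi => hp i (hs ▸ Multiset.mem_cons_of_mem hi)
      · exact Nat.Partition.ext hs.symm
  · congr 1
    ext p
    simp only [Finset.mem_filter, Finset.mem_univ, true_and, Finset.mem_insert]
    constructor
    · rintro ⟨h, hn⟩ i hi
      exact (h i hi).resolve_left fun e => hn (e ▸ hi)
    · exact fun h => ⟨fun i hi => Or.inr (h i hi), fun hi => haA (h a hi)⟩

/-- Parts exceeding `n` do not contribute to partitions of `n`. -/
theorem partCount_insert_of_lt {A : Finset ℕ} {a n : ℕ} (h : n < a) :
    partCount (insert a A) n = partCount A n := by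
  unfold partCount
  congr 1
  ext p
  simp only [Finset.mem_filter, Finset.mem_univ, true_and, Finset.mem_insert]
  refine forall₂_congr fun i hi => or_iff_right ?_
  have := p.parts_sum ▸ Multiset.le_sum_of_mem hi
  omega

theorem partCount_zero (A : Finset ℕ) : partCount A 0 = 1 := by
  unfold partCount
  rw [Finset.card_eq_one]
  refine ⟨default, Finset.eq_singleton_iff_unique_mem.2 ⟨?_, fun _ _ => Subsingleton.elim _ _⟩⟩
  simp [Subsingleton.elim (default : Nat.Partition 0) (Nat.Partition.indiscrete 0)]

theorem partCount_empty_succ (n : ℕ) : partCount ∅ (n + 1) = 0 := by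
  unfold partCount
  rw [Finset.card_eq_zero, Finset.filter_eq_empty_iff]
  intro p _ h
  have hs := p.parts_sum
  rw [Multiset.eq_zero_of_forall_notMem fun i hi => Finset.notMem_empty i (h i hi)] at hs
  simp at hs

theorem partCount_one (n : ℕ) : partCount {1} n = 1 := by
  induction n with
  | zero => exact partCount_zero _
  | succ n ih =>
    have h := partCount_insert_add (A := ∅) one_pos (by simp) n
    rw [partCount_empty_succ] at h
    exact h.trans (by simpa using ih)

theorem partCount_one_two_add (n : ℕ) :
    partCount {1, 2} (n + 2) = partCount {1, 2} n + 1 := by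
  rw [Finset.pair_comm, partCount_insert_add two_pos (by decide), partCount_one]

theorem partCount_one_two (n : ℕ) : partCount {1, 2} n = n / 2 + 1 := by
  induction n using Nat.twoStepInduction with
  | zero => exact partCount_zero _
  | one => rw [Finset.pair_comm, partCount_insert_of_lt one_lt_two, partCount_one]
  | more n ih _ => rw [partCount_one_two_add, ih]; omega

theorem partCount_one_two_three_add (n : ℕ) :
    partCount {1, 2, 3} (n + 3) = partCount {1, 2, 3} n + ((n + 3) / 2 + 1) := by
  rw [show ({1, 2, 3} : Finset ℕ) = insert 3 {1, 2} by decide,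
    partCount_insert_add three_pos (by decide), partCount_one_two]

theorem partCount_one_two_three_of_lt {n : ℕ} (h : n < 3) :
    partCount {1, 2, 3} n = n / 2 + 1 := by
  rw [show ({1, 2, 3} : Finset ℕ) = insert 3 {1, 2} by decide,
    partCount_insert_of_lt h, partCount_one_two]

/-- The number of partitions of `n` into parts at most `3` is `(n + 3) ^ 2 / 12`, rounded. -/
theorem partCount_one_two_three (n : ℕ) : partCount {1, 2, 3} n = (n ^ 2 + 6 * n + 15) / 12 := by
  induction n using Nat.strong_induction_on with
  | _ n ih =>
    rcases lt_or_ge n 6 with h | h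
    · interval_cases n
      · simp [partCount_one_two_three_of_lt]
      · simp [partCount_one_two_three_of_lt]
      · simp [partCount_one_two_three_of_lt]
      · simp [partCount_one_two_three_add 0, partCount_one_two_three_of_lt]
      · simp [partCount_one_two_three_add 1, partCount_one_two_three_of_lt]
      · simp [partCount_one_two_three_add 2, partCount_one_two_three_of_lt]
    · obtain ⟨m, rfl⟩ := Nat.exists_eq_add_of_le' h
      rw [partCount_one_two_three_add (m + 3), partCount_one_two_three_add, ih m (by omega),
        show (m + 6) ^ 2 + 6 * (m + 6) + 15 = m ^ 2 + 6 * m + 15 + (m + 6) * 12 by ring,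
        Nat.add_mul_div_right _ _ (by norm_num)]
      omega

theorem partCount_one_two_three_four_add (n : ℕ) :
    partCount {1, 2, 3, 4} (n + 4) =
      partCount {1, 2, 3, 4} n + ((n + 4) ^ 2 + 6 * (n + 4) + 15) / 12 := by
  rw [show ({1, 2, 3, 4} : Finset ℕ) = insert 4 {1, 2, 3} by decide,
    partCount_insert_add four_pos (by decide), partCount_one_two_three]

theorem partCount_one_two_three_four_of_lt {n : ℕ} (h : n < 4) :
    partCount {1, 2, 3, 4} n = (n ^ 2 + 6 * n + 15) / 12 := by
  rw [show ({1, 2, 3, 4} : Finset ℕ) = insert 4 {1, 2, 3} by decide,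
    partCount_insert_of_lt h, partCount_one_two_three]

theorem quadratic_div_twelve_add (k s : ℕ) :
    ((12 * k + s) ^ 2 + 6 * (12 * k + s) + 15) / 12 =
      12 * k ^ 2 + (2 * s + 6) * k + (s ^ 2 + 6 * s + 15) / 12 := by
  rw [show (12 * k + s) ^ 2 + 6 * (12 * k + s) + 15 =
      s ^ 2 + 6 * s + 15 + (12 * k ^ 2 + (2 * s + 6) * k) * 12 by ring,
    Nat.add_mul_div_right _ _ (by norm_num), add_comm]

/-- On each residue class modulo `12`, the number of partitions into parts at most `4` is a cubic
polynomial. -/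
theorem partCount_one_two_three_four (k r : ℕ) :
    partCount {1, 2, 3, 4} (12 * k + r) + (3 * r + 27) * k =
      12 * k ^ 3 + (3 * r + 15) * k ^ 2 +
        (((r + 4) ^ 2 + 6 * (r + 4) + 15) / 12 + ((r + 8) ^ 2 + 6 * (r + 8) + 15) / 12 +
          ((r + 12) ^ 2 + 6 * (r + 12) + 15) / 12) * k + partCount {1, 2, 3, 4} r := by
  induction k with
  | zero => simp
  | succ k ih =>
    have h (s t : ℕ) (hst : s = t + 4) : partCount {1, 2, 3, 4} (12 * k + (r + s)) =
        partCount {1, 2, 3, 4} (12 * k + (r + t)) + (12 * k ^ 2 + (2 * (r + s) + 6) * k +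
          ((r + s) ^ 2 + 6 * (r + s) + 15) / 12) := by
      subst hst
      rw [← quadratic_div_twelve_add]
      exact partCount_one_two_three_four_add (12 * k + (r + t))
    rw [show 12 * (k + 1) + r = 12 * k + (r + 12) by ring, h 12 8 rfl, h 8 4 rfl, h 4 0 rfl,
      add_zero]
    linear_combination ih

theorem stmt3 (n : ℕ) :
    2 * partCount {1, 2, 3, 4} (6 * n + 1) = (n + 1) * (3 * n ^ 2 + 6 * n + 2) ∧
    2 * partCount {1, 2, 3, 4} (6 * n + 3) = 3 * (n + 1) ^ 2 * (n + 2) ∧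
    2 * partCount {1, 2, 3, 4} (6 * n + 5) = 3 * (n + 1) * (n + 2) ^ 2 ∧
    partCount {1, 2, 3, 4} (12 * n) = 12 * n ^ 3 + 15 * n ^ 2 + 6 * n + 1 ∧
    partCount {1, 2, 3, 4} (12 * n + 2) = 12 * n ^ 3 + 21 * n ^ 2 + 12 * n + 2 ∧
    partCount {1, 2, 3, 4} (12 * n + 4) = (n + 1) * (12 * n ^ 2 + 15 * n + 5) ∧
    partCount {1, 2, 3, 4} (12 * n + 6) = 3 * (n + 1) ^ 2 * (4 * n + 3) ∧
    partCount {1, 2, 3, 4} (12 * n + 8) = 3 * (n + 1) ^ 2 * (4 * n + 5) ∧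
    partCount {1, 2, 3, 4} (12 * n + 10) = (n + 1) * (12 * n ^ 2 + 33 * n + 23) := by
  have v0 : partCount {1, 2, 3, 4} 0 = 1 :=
    partCount_one_two_three_four_of_lt (by norm_num)
  have v1 : partCount {1, 2, 3, 4} 1 = 1 :=
    partCount_one_two_three_four_of_lt (by norm_num)
  have v2 : partCount {1, 2, 3, 4} 2 = 2 :=
    partCount_one_two_three_four_of_lt (by norm_num)
  have v3 : partCount {1, 2, 3, 4} 3 = 3 :=
    partCount_one_two_three_four_of_lt (by norm_num)
  have v4 := partCount_one_two_three_four_add 0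
  have v5 := partCount_one_two_three_four_add 1
  have v6 := partCount_one_two_three_four_add 2
  have v7 := partCount_one_two_three_four_add 3
  have v8 := partCount_one_two_three_four_add 4
  have v9 := partCount_one_two_three_four_add 5
  have v10 := partCount_one_two_three_four_add 6
  have v11 := partCount_one_two_three_four_add 7
  norm_num [v0, v1, v2, v3] at v4 v5 v6 v7
  norm_num [v4, v5, v6, v7] at v8 v9 v10 v11
  have h0 := partCount_one_two_three_four n 0
  have h2 := partCount_one_two_three_four n 2
  have h4 := partCount_one_two_three_four n 4
  have h6 := partCount_one_two_three_four n 6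
  have h8 := partCount_one_two_three_four n 8
  have h10 := partCount_one_two_three_four n 10
  norm_num [v0, v2, v4, v6, v8, v10] at h0 h2 h4 h6 h8 h10
  refine ⟨?_, ?_, ?_, by linarith, by linarith, by linarith, by linarith, by linarith, by linarith⟩
  · obtain ⟨m, rfl | rfl⟩ := Nat.even_or_odd' n
    · have h := partCount_one_two_three_four m 1
      norm_num [v1] at h
      rw [show 6 * (2 * m) + 1 = 12 * m + 1 by ring]
      linarith
    · have h := partCount_one_two_three_four m 7
      norm_num [v7] at h
      rw [show 6 * (2 * m + 1) + 1 = 12 * m + 7 by ring]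
      linarith
  · obtain ⟨m, rfl | rfl⟩ := Nat.even_or_odd' n
    · have h := partCount_one_two_three_four m 3
      norm_num [v3] at h
      rw [show 6 * (2 * m) + 3 = 12 * m + 3 by ring]
      linarith
    · have h := partCount_one_two_three_four m 9
      norm_num [v9] at h
      rw [show 6 * (2 * m + 1) + 3 = 12 * m + 9 by ring]
      linarith
  · obtain ⟨m, rfl | rfl⟩ := Nat.even_or_odd' n
    · have h := partCount_one_two_three_four m 5
      norm_num [v5] at h
      rw [show 6 * (2 * m) + 5 = 12 * m + 5 by ring]
      linarith
    · have h := partCount_one_two_three_four m 11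
      norm_num [v11] at h
      rw [show 6 * (2 * m + 1) + 5 = 12 * m + 11 by ring]
      linarith
end

section
/- Let c ≥ 2 be an integer, a = 2c, and A = {1, 2, a}. Then for every natural number n and every integer i with 0 ≤ i ≤ 4c − 1 one has P_A(4cn + i) = 2cn² + (c + 2⌊i/2⌋ + 2)n + E, where E = ⌊i/2⌋ + 1 if 0 ≤ i ≤ 2c − 1, and E = 2⌊i/2⌋ + 2 − c if 2c ≤ i ≤ 4c − 1. -/
/-- Partitions of `N` into parts `1`, `2`, `2 * c`, sorted by the multiplicity of the part `2 * c`. -/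
theorem partCount_one_two_even (c : ℕ) (hc : 2 ≤ c) (N : ℕ) :
    partCount {1, 2, 2 * c} N =
      ∑ k ∈ Finset.range (N / (2 * c) + 1), ((N - 2 * c * k) / 2 + 1) := by
  have hsum : ∀ p : Nat.Partition N, (∀ i ∈ p.parts, i ∈ ({1, 2, 2 * c} : Finset ℕ)) →
      p.parts.count 1 + p.parts.count 2 * 2 + p.parts.count (2 * c) * (2 * c) = N := by
    intro p hp
    have h := Finset.sum_multiset_count_of_subset p.parts {1, 2, 2 * c}
      (fun x hx => hp x (Multiset.mem_toFinset.1 hx))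
    rw [p.parts_sum, Finset.sum_insert (by simp; omega), Finset.sum_insert (by simp; omega),
      Finset.sum_singleton] at h
    simp only [smul_eq_mul] at h
    omega
  have hcard : ∑ k ∈ Finset.range (N / (2 * c) + 1), ((N - 2 * c * k) / 2 + 1) =
      ((Finset.range (N / (2 * c) + 1)).sigma
        fun k => Finset.range ((N - 2 * c * k) / 2 + 1)).card := by
    simp [Finset.card_sigma]
  rw [hcard, partCount]
  refine Finset.card_bij (fun p _ => ⟨p.parts.count (2 * c), p.parts.count 2⟩) ?_ ?_ ?_
  · intro p hp
    have h := hsum p (Finset.mem_filter.1 hp).2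
    simp only [Finset.mem_sigma, Finset.mem_range, Nat.lt_succ_iff]
    rw [Nat.le_div_iff_mul_le (by omega), mul_comm (2 * c)]
    omega
  · intro p hp q hq h
    have hp' := (Finset.mem_filter.1 hp).2
    have hq' := (Finset.mem_filter.1 hq).2
    have h₁ := hsum p hp'
    have h₂ := hsum q hq'
    simp only [Sigma.mk.injEq, heq_eq_eq] at h
    rw [h.1, h.2] at h₁
    have h1 : p.parts.count 1 = q.parts.count 1 := by omega
    ext x
    by_cases hx : x ∈ ({1, 2, 2 * c} : Finset ℕ)
    · simp only [Finset.mem_insert, Finset.mem_singleton] at hx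
      rcases hx with rfl | rfl | rfl
      exacts [h1, h.2, h.1]
    · rw [Multiset.count_eq_zero_of_notMem fun h => hx (hp' x h),
        Multiset.count_eq_zero_of_notMem fun h => hx (hq' x h)]
  · rintro ⟨k, j⟩ hkj
    simp only [Finset.mem_sigma, Finset.mem_range, Nat.lt_succ_iff] at hkj
    rw [Nat.le_div_iff_mul_le (by omega), mul_comm k] at hkj
    have hmem : ∀ x ∈ Multiset.replicate k (2 * c) + Multiset.replicate j 2 +
        Multiset.replicate (N - 2 * c * k - 2 * j) 1, x = 1 ∨ x = 2 ∨ x = 2 * c := by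
      intro x hx
      simp only [Multiset.mem_add, Multiset.mem_replicate] at hx
      tauto
    refine ⟨⟨Multiset.replicate k (2 * c) + Multiset.replicate j 2 +
        Multiset.replicate (N - 2 * c * k - 2 * j) 1, ?_, ?_⟩, ?_, ?_⟩
    · intro x hx
      have := hmem x hx
      omega
    · simp only [Multiset.sum_add, Multiset.sum_replicate, smul_eq_mul]
      rw [mul_comm k]
      omega
    · simpa using hmem
    · have h2 : 2 ≠ 2 * c := by omega
      have h1 : 1 ≠ 2 * c := by omega
      simp [Multiset.count_replicate, h2, h2.symm, h1]

theorem two_mul_sum_range_sub_mul_add_one (c M K : ℕ) :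
    2 * (∑ k ∈ Finset.range K, ((M : ℤ) - c * k + 1)) = K * (2 * M + 2 - c * (K - 1)) := by
  induction K with
  | zero => simp
  | succ K ih =>
    rw [Finset.sum_range_succ, mul_add, ih]
    push_cast
    ring

theorem stmt8 (c : ℕ) (hc : 2 ≤ c) (n i : ℕ) (hi : i ≤ 4 * c - 1) :
    partCount {1, 2, 2 * c} (4 * c * n + i) =
      2 * c * n ^ 2 + (c + 2 * (i / 2) + 2) * n +
        (if i ≤ 2 * c - 1 then i / 2 + 1 else 2 * (i / 2) + 2 - c) := by
  rw [partCount_one_two_even c hc]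
  have hM : (4 * c * n + i) / 2 = 2 * c * n + i / 2 := by
    rw [show 4 * c * n = 2 * (2 * c * n) by ring]
    omega
  have hcast : ((∑ k ∈ Finset.range ((4 * c * n + i) / (2 * c) + 1),
      ((4 * c * n + i - 2 * c * k) / 2 + 1) : ℕ) : ℤ) =
      ∑ k ∈ Finset.range ((4 * c * n + i) / (2 * c) + 1),
        (((2 * c * n + i / 2 : ℕ) : ℤ) - c * k + 1) := by
    push_cast [Nat.cast_sum]
    refine Finset.sum_congr rfl fun k hk => ?_
    rw [Finset.mem_range, Nat.lt_succ_iff, Nat.le_div_iff_mul_le (by omega)] at hk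
    have e : k * (2 * c) = 2 * (c * k) := by ring
    have e' : 2 * c * k = 2 * (c * k) := by ring
    have e'' : 2 * c * n = 2 * (c * n) := by ring
    have e''' : 4 * c * n = 4 * (c * n) := by ring
    have key : (4 * c * n + i - 2 * c * k) / 2 + c * k = 2 * c * n + i / 2 := by
      rw [e', e'', e''']
      rw [e, e'''] at hk
      omega
    zify at key
    linarith
  have hsum := two_mul_sum_range_sub_mul_add_one c (2 * c * n + i / 2)
    ((4 * c * n + i) / (2 * c) + 1)
  rw [← hcast] at hsum
  split_ifs with h
  · have hK : (4 * c * n + i) / (2 * c) = 2 * n := by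
      rw [show 4 * c * n + i = i + 2 * c * (2 * n) by ring, Nat.add_mul_div_left _ _ (by omega),
        Nat.div_eq_of_lt (by omega), zero_add]
    rw [hK] at hsum ⊢
    zify
    push_cast at hsum ⊢
    linarith
  · have hK : (4 * c * n + i) / (2 * c) = 2 * n + 1 := by
      rw [show 4 * c * n + i = i + 2 * c * (2 * n) by ring, Nat.add_mul_div_left _ _ (by omega),
        Nat.div_eq_of_lt_le (k := 1) (by omega) (by omega), add_comm]
    rw [hK] at hsum ⊢
    have hsub : c ≤ 2 * (i / 2) + 2 := by omega
    zify [hsub]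
    push_cast at hsum ⊢
    linarith
end

section
/- Let c ≥ 1 be an integer, a = 2c + 1, and A = {1, 2, a}. Then for every natural number n and every integer i with 0 ≤ i ≤ 4c + 1 one has P_A(2(2c+1)n + i) = (2c+1)n² + (c + i + 2)n + E, where E = ⌊(i+2)/2⌋ if 0 ≤ i ≤ 2c, and E = i + 1 − c if 2c + 1 ≤ i ≤ 4c + 1. -/
theorem multiset_eq_replicate_of_mem_triple {a : ℕ} (ha : 2 < a) {s : Multiset ℕ}
    (hs : ∀ i ∈ s, i ∈ ({1, 2, a} : Finset ℕ)) :
    s = Multiset.replicate (s.count 1) 1 + Multiset.replicate (s.count 2) 2 +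
      Multiset.replicate (s.count a) a := by
  ext x
  simp only [Multiset.count_add, Multiset.count_replicate]
  by_cases hx : x ∈ s
  · have h := hs x hx
    simp only [Finset.mem_insert, Finset.mem_singleton] at h
    rcases h with rfl | rfl | rfl
    · simp [show a ≠ 1 by omega]
    · simp [show a ≠ 2 by omega]
    · simp [show 1 ≠ x by omega, show 2 ≠ x by omega]
  · have h0 := Multiset.count_eq_zero_of_notMem hx
    split_ifs <;> subst_vars <;> omega

theorem partCount_triple_eq_sum {a : ℕ} (ha : 2 < a) (m : ℕ) :
    partCount {1, 2, a} m = ∑ k ∈ Finset.range (m / a + 1), ((m - a * k) / 2 + 1) := by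
  have hle {k j : ℕ} (hk : k < m / a + 1) (hj : j < (m - a * k) / 2 + 1) :
      a * k + 2 * j ≤ m := by
    have h1 : a * k ≤ m := (Nat.mul_le_mul_left a (Nat.lt_succ_iff.mp hk)).trans
      (Nat.mul_div_le m a)
    omega
  have hcard : ∑ k ∈ Finset.range (m / a + 1), ((m - a * k) / 2 + 1) =
      ((Finset.range (m / a + 1)).sigma
        (fun k => Finset.range ((m - a * k) / 2 + 1))).card := by
    simp
  rw [hcard, partCount, eq_comm]
  refine Finset.card_bij
    (fun x hx => ⟨Multiset.replicate (m - a * x.1 - 2 * x.2) 1 +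
      Multiset.replicate x.2 2 + Multiset.replicate x.1 a, ?_, ?_⟩) ?_ ?_ ?_
  · intro i hi
    simp only [Multiset.mem_add, Multiset.mem_replicate] at hi
    omega
  · simp only [Finset.mem_sigma, Finset.mem_range] at hx
    have := hle hx.1 hx.2
    simp only [Multiset.sum_add, Multiset.sum_replicate, smul_eq_mul, mul_one,
      mul_comm x.1 a]
    omega
  · intro x hx
    simp only [Finset.mem_filter, Finset.mem_univ, true_and, Multiset.mem_add,
      Multiset.mem_replicate, Finset.mem_insert, Finset.mem_singleton]
    intro i hi
    omega
  · rintro ⟨k, j⟩ hx ⟨k', j'⟩ hx' h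
    have h := congrArg Nat.Partition.parts h
    have h2 := congrArg (Multiset.count 2) h
    have h3 := congrArg (Multiset.count a) h
    simp [Multiset.count_replicate, show a ≠ 2 by omega] at h2
    simp [Multiset.count_replicate, show 1 ≠ a by omega, show 2 ≠ a by omega] at h3
    subst h2 h3
    rfl
  · intro p hp
    have hp := multiset_eq_replicate_of_mem_triple ha (Finset.mem_filter.mp hp).2
    have hsum := congrArg Multiset.sum hp
    simp only [p.parts_sum, Multiset.sum_add, Multiset.sum_replicate, smul_eq_mul, mul_one,
      mul_comm _ a] at hsum
    refine ⟨⟨p.parts.count a, p.parts.count 2⟩, ?_, ?_⟩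
    · simp only [Finset.mem_sigma, Finset.mem_range]
      refine ⟨?_, by omega⟩
      rw [Nat.lt_succ_iff, Nat.le_div_iff_mul_le (by omega), mul_comm]
      omega
    · apply Nat.Partition.ext
      conv_rhs => rw [hp]
      have h1 : m - a * p.parts.count a - 2 * p.parts.count 2 = p.parts.count 1 := by omega
      simp only [h1]

theorem partCount_triple_add_two_mul (c : ℕ) (hc : 1 ≤ c) (m : ℕ) :
    partCount {1, 2, 2 * c + 1} (m + 2 * (2 * c + 1)) =
      partCount {1, 2, 2 * c + 1} m + (m + 3 * c + 3) := by
  rw [partCount_triple_eq_sum (by omega), partCount_triple_eq_sum (by omega),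
    Nat.add_mul_div_right _ _ (by omega), Finset.sum_range_succ', Finset.sum_range_succ',
    add_assoc]
  congr 1
  · refine Finset.sum_congr rfl fun k _ => ?_
    congr 2
    have : (2 * c + 1) * (k + 1 + 1) = (2 * c + 1) * k + 2 * (2 * c + 1) := by ring
    omega
  · simp only [zero_add, mul_one, mul_zero]
    omega

theorem partCount_triple_of_le (c : ℕ) (hc : 1 ≤ c) (i : ℕ) (hi : i ≤ 4 * c + 1) :
    partCount {1, 2, 2 * c + 1} i = if i ≤ 2 * c then (i + 2) / 2 else i + 1 - c := by
  rw [partCount_triple_eq_sum (by omega)]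
  split_ifs with h
  · rw [Nat.div_eq_of_lt (by omega)]
    simp
  · have h1 : i / (2 * c + 1) = 1 := Nat.div_eq_of_lt_le (by omega) (by omega)
    rw [h1]
    simp only [Finset.sum_range_succ, Finset.sum_range_zero, mul_zero, mul_one]
    omega

theorem stmt9 (c : ℕ) (hc : 1 ≤ c) (n i : ℕ) (hi : i ≤ 4 * c + 1) :
    partCount {1, 2, 2 * c + 1} (2 * (2 * c + 1) * n + i) =
      (2 * c + 1) * n ^ 2 + (c + i + 2) * n +
        (if i ≤ 2 * c then (i + 2) / 2 else i + 1 - c) := by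
  induction n with
  | zero => simpa using partCount_triple_of_le c hc i hi
  | succ n ih =>
    rw [show 2 * (2 * c + 1) * (n + 1) + i = 2 * (2 * c + 1) * n + i + 2 * (2 * c + 1) by ring,
      partCount_triple_add_two_mul c hc, ih]
    ring
end

section
/- Let a ≥ 3 be an odd integer and A = {1, 2, a}. Then for a positive integer n one has P_A(n) = P_A(n + 1) if and only if n is even and n ≤ a − 3 (equivalently, n = 2j for some j with 1 ≤ j ≤ (a−3)/2). -/
/-- Removing one part `a` identifies the partitions of `n + a` into parts from `A` that use `a`
with the partitions of `n` into parts from `A`. -/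
theorem partCount_add_partCount_erase {A : Finset ℕ} {a : ℕ} (ha : a ∈ A) (hpos : 0 < a) (n : ℕ) :
    partCount A n + partCount (A.erase a) (n + a) = partCount A (n + a) := by
  unfold partCount
  rw [← Finset.card_filter_add_card_filter_not (s := Finset.univ.filter
    fun p : Nat.Partition (n + a) => ∀ i ∈ p.parts, i ∈ A) (fun p => a ∈ p.parts)]
  congr 1
  · refine Finset.card_bij
      (fun p _ => ⟨a ::ₘ p.parts, ?_, by rw [Multiset.sum_cons, p.parts_sum, add_comm]⟩) ?_ ?_ ?_
    · intro i hi
      rcases Multiset.mem_cons.mp hi with rfl | hi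
      · exact hpos
      · exact p.parts_pos hi
    · intro p hp
      simp only [Finset.mem_filter, Finset.mem_univ, true_and] at hp ⊢
      simpa [ha] using hp
    · intro p _ q _ h
      simpa [Nat.Partition.ext_iff] using h
    · intro q hq
      simp only [Finset.mem_filter, Finset.mem_univ, true_and] at hq
      have hcons := Multiset.cons_erase hq.2
      refine ⟨⟨q.parts.erase a, fun hi => q.parts_pos (Multiset.mem_of_mem_erase hi), ?_⟩, ?_, ?_⟩
      · have hsum := q.parts_sum
        rw [← hcons, Multiset.sum_cons] at hsum
        omega
      · simpa using fun i hi => hq.1 i (Multiset.mem_of_mem_erase hi)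
      · exact Nat.Partition.ext hcons
  · rw [Finset.filter_filter]
    congr 1
    ext p
    simp only [Finset.mem_filter, Finset.mem_univ, true_and, Finset.mem_erase]
    exact ⟨fun h => ⟨fun i hi => (h i hi).2, fun hmem => (h a hmem).1 rfl⟩,
      fun h i hi => ⟨fun hia => h.2 (hia ▸ hi), h.1 i hi⟩⟩

theorem partCount_eq_zero_iff {A : Finset ℕ} {n : ℕ} :
    partCount A n = 0 ↔ ∀ p : Nat.Partition n, ¬ ∀ i ∈ p.parts, i ∈ A := by
  simp only [partCount, Finset.card_eq_zero, Finset.filter_eq_empty_iff, Finset.mem_univ,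
    forall_const]

theorem partCount_two_odd_eq_zero_iff {a : ℕ} (hodd : Odd a) (n : ℕ) :
    partCount {2, a} n = 0 ↔ Odd n ∧ n < a := by
  rw [partCount_eq_zero_iff]
  constructor
  · intro h
    by_contra! hn
    rcases Nat.even_or_odd n with he | ho
    · obtain ⟨k, rfl⟩ := even_iff_exists_two_mul.mp he
      refine h ⟨Multiset.replicate k 2, fun hi => ?_, by simp [mul_comm]⟩ fun i hi => ?_
      · simp [Multiset.eq_of_mem_replicate hi]
      · simp [Multiset.eq_of_mem_replicate hi]
    · have hle := hn ho
      obtain ⟨k, hk⟩ := even_iff_exists_two_mul.mp (Nat.Odd.sub_odd ho hodd)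
      refine h ⟨a ::ₘ Multiset.replicate k 2, fun hi => ?_, ?_⟩ fun i hi => ?_
      · rcases Multiset.mem_cons.mp hi with rfl | hi
        · exact hodd.pos
        · simp [Multiset.eq_of_mem_replicate hi]
      · simp only [Multiset.sum_cons, Multiset.sum_replicate, smul_eq_mul]
        omega
      · rcases Multiset.mem_cons.mp (show i ∈ a ::ₘ Multiset.replicate k 2 from hi) with rfl | hi
        · simp
        · simp [Multiset.eq_of_mem_replicate hi]
  · rintro ⟨ho, hlt⟩ p hp
    refine Nat.not_even_iff_odd.mpr ho (even_iff_two_dvd.mpr ?_)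
    rw [← p.parts_sum]
    refine Multiset.dvd_sum fun i hi => ?_
    have hle := Multiset.le_sum_of_mem hi
    rw [p.parts_sum] at hle
    have hi2 := hp i hi
    simp only [Finset.mem_insert, Finset.mem_singleton] at hi2
    rcases hi2 with rfl | rfl
    · exact dvd_rfl
    · omega

theorem stmt12 (a : ℕ) (ha : 3 ≤ a) (hodd : Odd a) (n : ℕ) (hn : 0 < n) :
    partCount {1, 2, a} n = partCount {1, 2, a} (n + 1) ↔ Even n ∧ n ≤ a - 3 := by
  have hrec := partCount_add_partCount_erase (A := {1, 2, a}) (a := 1) (by simp) one_pos n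
  rw [Finset.erase_insert (by simp; omega)] at hrec
  have hzero := partCount_two_odd_eq_zero_iff hodd (n + 1)
  have hiff : partCount {1, 2, a} n = partCount {1, 2, a} (n + 1) ↔
      partCount {2, a} (n + 1) = 0 := by omega
  rw [hiff, hzero]
  rw [Nat.odd_iff] at hodd ⊢
  rw [Nat.even_iff]
  omega
end

section
/- Let a ≥ 3 be an integer with a ≡ 2 (mod 4) and A = {1, 2, a}. Then the Diophantine equation P_A(m) = P₄(n) has only finitely many solutions in natural numbers, i.e., the set {(m, n) ∈ ℕ × ℕ : P_A(m) = P₄(n)} is finite. -/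
section Thue

open Polynomial Filter Topology

theorem four_mul_le_natDegree_of_pow_dvd {θ : ℝ} (hθ : IsIntegral ℚ θ)
    (hdeg : (minpoly ℚ θ).natDegree = 4) (n : ℕ) :
    ∀ g : ℚ[X], g ≠ 0 → (X - C θ) ^ n ∣ g.map (algebraMap ℚ ℝ) → 4 * n ≤ g.natDegree := by
  induction n with
  | zero => simp
  | succ n ih =>
    intro g hg hdvd
    have hroot : aeval θ g = 0 := by
      have h1 : (X - C θ) ∣ g.map (algebraMap ℚ ℝ) := (dvd_pow_self _ n.succ_ne_zero).trans hdvd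
      rw [dvd_iff_isRoot] at h1
      simpa [IsRoot, eval_map_algebraMap] using h1
    obtain ⟨h, rfl⟩ := minpoly.dvd ℚ θ hroot
    have hirr := minpoly.irreducible hθ
    have hh : h ≠ 0 := right_ne_zero_of_mul hg
    have hmroot : (X - C θ) ∣ (minpoly ℚ θ).map (algebraMap ℚ ℝ) := by
      rw [dvd_iff_isRoot]
      simp [IsRoot, eval_map_algebraMap]
    obtain ⟨m, hm⟩ := hmroot
    have hm0 : m.eval θ ≠ 0 := by
      intro h0
      have hsep : ((minpoly ℚ θ).map (algebraMap ℚ ℝ)).Separable :=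
        (hirr.separable).map
      have hsq := hsep.squarefree
      rw [hm] at hsq
      obtain ⟨m', rfl⟩ := dvd_iff_isRoot.mpr h0
      exact not_isUnit_X_sub_C θ (hsq (X - C θ) ⟨m', by ring⟩)
    have hcop : IsCoprime ((X - C θ) ^ n) m := by
      apply IsCoprime.pow_left
      rw [(irreducible_X_sub_C θ).coprime_iff_not_dvd, dvd_iff_isRoot]
      exact hm0
    have h2 : (X - C θ) ^ n ∣ h.map (algebraMap ℚ ℝ) := by
      refine hcop.dvd_of_dvd_mul_left ?_
      rw [Polynomial.map_mul, hm, pow_succ', mul_assoc] at hdvd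
      exact (mul_dvd_mul_iff_left (X_sub_C_ne_zero θ)).mp hdvd
    have := ih h hh h2
    rw [natDegree_mul (minpoly.ne_zero hθ) hh, hdeg]
    omega

theorem pow_le_abs_leadingCoeff_of_pow_dvd {p : ℤ} {q : ℕ} (hq : 0 < q)
    (hpq : IsCoprime p (q : ℤ)) (m : ℕ) :
    ∀ W : ℤ[X], W ≠ 0 → (X - C ((p : ℚ) / q)) ^ m ∣ W.map (Int.castRingHom ℚ) →
      (q : ℤ) ^ m ≤ |W.leadingCoeff| := by
  induction m with
  | zero =>
    intro W hW _
    simpa using Int.one_le_abs (leadingCoeff_ne_zero.mpr hW)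
  | succ m ih =>
    intro W hW hdvd
    have hq0 : (q : ℚ) ≠ 0 := by positivity
    set l : ℤ[X] := C (q : ℤ) * X - C p with hl
    have hlmap : l.map (Int.castRingHom ℚ) = C (q : ℚ) * (X - C ((p : ℚ) / q)) := by
      simp only [hl, Polynomial.map_sub, Polynomial.map_mul, map_C, map_X, mul_sub, ← C_mul]
      simp [mul_div_cancel₀ _ hq0]
    have hprim : l.IsPrimitive := by
      intro r hr
      rw [C_dvd_iff_dvd_coeff] at hr
      have h0 := hr 0
      have h1 := hr 1
      have e0 : l.coeff 0 = -p := by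
        simp only [hl, coeff_sub, coeff_C_mul, coeff_X_zero, coeff_C_zero]; ring
      have e1 : l.coeff 1 = q := by
        simp only [hl, coeff_sub, coeff_C_mul, coeff_X_one, coeff_C_succ]; ring
      rw [e0, dvd_neg] at h0
      rw [e1] at h1
      exact hpq.isUnit_of_dvd' h0 h1
    have hlW : l ∣ W := by
      rw [IsPrimitive.Int.dvd_iff_map_cast_dvd_map_cast _ _ hprim, hlmap]
      have hu' : IsUnit (C (q : ℚ)) := by
        rw [isUnit_C, isUnit_iff_ne_zero]; exact hq0
      rw [hu'.mul_left_dvd]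
      exact (dvd_pow_self _ m.succ_ne_zero).trans hdvd
    obtain ⟨V, rfl⟩ := hlW
    have hV : V ≠ 0 := right_ne_zero_of_mul hW
    have h3 : (X - C ((p : ℚ) / q)) ^ m ∣ V.map (Int.castRingHom ℚ) := by
      rw [Polynomial.map_mul, hlmap, pow_succ'] at hdvd
      have hu' : IsUnit (C (q : ℚ)) := by
        rw [isUnit_C, isUnit_iff_ne_zero]; exact hq0
      rw [mul_assoc, hu'.dvd_mul_left] at hdvd
      exact (mul_dvd_mul_iff_left (X_sub_C_ne_zero _)).mp hdvd
    have h4 := ih V hV h3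
    have hlc : l.leadingCoeff = q := by
      have : l = C (q : ℤ) * X + C (-p) := by simp [hl, sub_eq_add_neg]
      rw [this, leadingCoeff_linear]
      exact_mod_cast hq.ne'
    rw [leadingCoeff_mul, hlc, abs_mul, pow_succ', Nat.abs_cast]
    gcongr

theorem wronskian_ne_zero_of_pow_dvd {θ : ℝ} (hθ : IsIntegral ℚ θ)
    (hdeg : (minpoly ℚ θ).natDegree = 4) {n N : ℕ} (hn : N ≤ 4 * n) {P Q : ℚ[X]}
    (hPQ : P ≠ 0 ∨ Q ≠ 0) (hP : P.natDegree < N) (hQ : Q.natDegree < N)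
    (hdvd : (X - C θ) ^ n ∣ P.map (algebraMap ℚ ℝ) - C θ * Q.map (algebraMap ℚ ℝ)) :
    wronskian P Q ≠ 0 := by
  classical
  intro hW
  set g := EuclideanDomain.gcd P Q with hg
  have hg0 : g ≠ 0 := by
    intro h
    rw [hg, EuclideanDomain.gcd_eq_zero_iff] at h
    tauto
  obtain ⟨p, hp⟩ : g ∣ P := EuclideanDomain.gcd_dvd_left P Q
  obtain ⟨q, hq⟩ : g ∣ Q := EuclideanDomain.gcd_dvd_right P Q
  have hcop : IsCoprime p q := by
    obtain ⟨a, b, hab⟩ : ∃ a b, g = P * a + Q * b := ⟨_, _, EuclideanDomain.gcd_eq_gcd_ab P Q⟩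
    refine ⟨a, b, mul_left_cancel₀ hg0 ?_⟩
    calc g * (a * p + b * q) = (g * p) * a + (g * q) * b := by ring
      _ = g * 1 := by rw [← hp, ← hq, ← hab, mul_one]
  have hw : wronskian p q = 0 := by
    have : wronskian P Q = g ^ 2 * wronskian p q := by
      rw [hp, hq]; simp only [wronskian, derivative_mul]; ring
    rw [this] at hW
    exact (mul_eq_zero.mp hW).resolve_left (pow_ne_zero _ hg0)
  obtain ⟨hp', hq'⟩ := hcop.wronskian_eq_zero_iff.mp hw
  obtain ⟨a, rfl⟩ : ∃ a, C a = p := ⟨_, (eq_C_of_derivative_eq_zero hp').symm⟩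
  obtain ⟨b, rfl⟩ : ∃ b, C b = q := ⟨_, (eq_C_of_derivative_eq_zero hq').symm⟩
  have hab : (a : ℝ) - θ * b ≠ 0 := by
    intro h
    by_cases hb : b = 0
    · subst hb
      have ha : a = 0 := by simpa using h
      subst ha
      obtain ⟨u, v, huv⟩ := hcop
      simp at huv
    · have hb' : (b : ℝ) ≠ 0 := by exact_mod_cast hb
      have : θ = algebraMap ℚ ℝ (a / b) := by
        simp; field_simp; linarith
      rw [this, minpoly.eq_X_sub_C] at hdeg
      simp at hdeg
  have hdg : (X - C θ) ^ n ∣ g.map (algebraMap ℚ ℝ) := by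
    have he : P.map (algebraMap ℚ ℝ) - C θ * Q.map (algebraMap ℚ ℝ)
        = C ((a : ℝ) - θ * b) * g.map (algebraMap ℚ ℝ) := by
      rw [hp, hq]; simp [Polynomial.map_mul]; ring
    rw [he] at hdvd
    exact ((isUnit_C.mpr (isUnit_iff_ne_zero.mpr hab)).dvd_mul_left).mp hdvd
  have h4 := four_mul_le_natDegree_of_pow_dvd hθ hdeg n g hg0 hdg
  rcases hPQ with h | h
  · have := natDegree_le_of_dvd (Dvd.intro _ hp.symm) h
    omega
  · have := natDegree_le_of_dvd (Dvd.intro _ hq.symm) h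
    omega

theorem abs_eval_hasseDeriv_le {g : ℝ[X]} {N : ℕ} (hN : g.natDegree < N) {B : ℝ}
    (hB : ∀ i, |g.coeff i| ≤ B) {x M : ℝ} (hM : 1 ≤ M) (hx : |x| ≤ M) (j : ℕ) :
    |(hasseDeriv j g).eval x| ≤ N * (2 ^ N * B * M ^ N) := by
  have hB0 : 0 ≤ B := (abs_nonneg _).trans (hB 0)
  have hdeg : (hasseDeriv j g).natDegree < N :=
    lt_of_le_of_lt ((natDegree_hasseDeriv_le g j).trans (Nat.sub_le _ _)) hN
  rw [eval_eq_sum_range' hdeg]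
  refine (Finset.abs_sum_le_sum_abs _ _).trans ?_
  calc ∑ i ∈ Finset.range N, |(hasseDeriv j g).coeff i * x ^ i|
      ≤ ∑ i ∈ Finset.range N, 2 ^ N * B * M ^ N := by
        refine Finset.sum_le_sum fun i hi => ?_
        rw [abs_mul, abs_pow, hasseDeriv_coeff, abs_mul, Nat.abs_cast]
        have h1 : |x| ^ i ≤ M ^ N := by
          calc |x| ^ i ≤ M ^ i := by gcongr
            _ ≤ M ^ N := pow_le_pow_right₀ hM (Finset.mem_range.mp hi).le
        have h2 : (((i + j).choose j : ℕ) : ℝ) * |g.coeff (i + j)| ≤ 2 ^ N * B := by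
          by_cases hij : i + j < N
          · have : (((i + j).choose j : ℕ) : ℝ) ≤ 2 ^ N := by
              have h3 : (i + j).choose j ≤ 2 ^ N :=
                (Nat.choose_le_two_pow _ _).trans (Nat.pow_le_pow_right (by norm_num) hij.le)
              exact_mod_cast h3
            gcongr
            exact hB _
          · rw [coeff_eq_zero_of_natDegree_lt (by omega)]
            simp only [abs_zero, mul_zero]
            positivity
        gcongr
    _ = N * (2 ^ N * B * M ^ N) := by simp

theorem abs_eval_hasseDeriv_le_of_vanish {g : ℝ[X]} {N n : ℕ} (hN : g.natDegree < N) {B : ℝ}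
    (hB : ∀ i, |g.coeff i| ≤ B) {θ M : ℝ} (hM : 1 ≤ M) (hθ : |θ| ≤ M)
    (hv : ∀ i < n, (hasseDeriv i g).eval θ = 0) {x : ℝ} (hx : |x - θ| ≤ 1) (j : ℕ) :
    |(hasseDeriv j g).eval x| ≤ N * (2 ^ N * (N * (2 ^ N * B * M ^ N))) * |x - θ| ^ (n - j) := by
  have hB0 : 0 ≤ B := (abs_nonneg _).trans (hB 0)
  have hdeg : (hasseDeriv j g).natDegree < N :=
    lt_of_le_of_lt ((natDegree_hasseDeriv_le g j).trans (Nat.sub_le _ _)) hN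
  have he : (hasseDeriv j g).eval x = (taylor θ (hasseDeriv j g)).eval (x - θ) := by
    rw [taylor_eval]; ring_nf
  rw [he, eval_eq_sum_range' (by rw [natDegree_taylor]; exact hdeg)]
  refine (Finset.abs_sum_le_sum_abs _ _).trans ?_
  calc ∑ i ∈ Finset.range N, |(taylor θ (hasseDeriv j g)).coeff i * (x - θ) ^ i|
      ≤ ∑ i ∈ Finset.range N, 2 ^ N * (N * (2 ^ N * B * M ^ N)) * |x - θ| ^ (n - j) := by
        refine Finset.sum_le_sum fun i hi => ?_
        have hc : (taylor θ (hasseDeriv j g)).coeff i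
            = ((i + j).choose i : ℕ) * (hasseDeriv (i + j) g).eval θ := by
          rw [taylor_coeff, ← LinearMap.comp_apply, hasseDeriv_comp]
          simp
        rw [hc, abs_mul, abs_mul, abs_pow, Nat.abs_cast]
        by_cases h1 : i + j < n
        · rw [hv _ h1]
          simp only [abs_zero, mul_zero, zero_mul]
          positivity
        by_cases hij : i + j < N
        · have h2 : (((i + j).choose i : ℕ) : ℝ) ≤ 2 ^ N := by
            have h3 : (i + j).choose i ≤ 2 ^ N :=
              (Nat.choose_le_two_pow _ _).trans (Nat.pow_le_pow_right (by norm_num) hij.le)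
            exact_mod_cast h3
          have h4 := abs_eval_hasseDeriv_le hN hB hM hθ (i + j)
          have h5 : |x - θ| ^ i ≤ |x - θ| ^ (n - j) :=
            pow_le_pow_of_le_one (abs_nonneg _) hx (by omega)
          gcongr
        · rw [hasseDeriv_eq_zero_of_lt_natDegree _ _ (by omega)]
          simp only [eval_zero, abs_zero, mul_zero, zero_mul]
          positivity
    _ = _ := by simp [mul_assoc]

theorem exists_pow_eq_sum {θ : ℝ} {u : Fin 4 → ℤ}
    (hu : θ ^ 4 = u 0 + u 1 * θ + u 2 * θ ^ 2 + u 3 * θ ^ 3) :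
    ∃ K : ℕ, 1 ≤ K ∧ ∀ j : ℕ, ∃ c : Fin 4 → ℤ, (∀ l, |c l| ≤ (K : ℤ) ^ j) ∧
      θ ^ j = ∑ l, (c l : ℝ) * θ ^ (l : ℕ) := by
  obtain ⟨U, hU⟩ : ∃ U : ℕ, ∀ l, |u l| ≤ (U : ℤ) := by
    refine ⟨∑ l, (u l).natAbs, fun l => ?_⟩
    rw [Int.abs_eq_natAbs]
    exact_mod_cast Finset.single_le_sum (f := fun l => (u l).natAbs) (fun _ _ => Nat.zero_le _)
      (Finset.mem_univ l)
  refine ⟨U + 1, by omega, fun j => ?_⟩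
  induction j with
  | zero =>
    refine ⟨![1, 0, 0, 0], fun l => ?_, ?_⟩
    · fin_cases l <;> simp
    · simp [Fin.sum_univ_four]
  | succ j ih =>
    obtain ⟨c, hc, he⟩ := ih
    have hK : (0 : ℤ) ≤ ((U + 1 : ℕ) : ℤ) ^ j := by positivity
    have key : ∀ l, |c 3 * u l| ≤ U * ((U + 1 : ℕ) : ℤ) ^ j := by
      intro l
      rw [abs_mul, mul_comm]
      exact mul_le_mul (hU l) (hc 3) (abs_nonneg _) (by positivity)
    have hs : ((U + 1 : ℕ) : ℤ) ^ (j + 1) = U * ((U + 1 : ℕ) : ℤ) ^ j + ((U + 1 : ℕ) : ℤ) ^ j := by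
      push_cast; ring
    refine ⟨![c 3 * u 0, c 3 * u 1 + c 0, c 3 * u 2 + c 1, c 3 * u 3 + c 2], fun l => ?_, ?_⟩
    · rw [hs]
      fin_cases l
      · exact (key 0).trans (by simpa using hK)
      · exact (abs_add_le _ _).trans (add_le_add (key 1) (hc 0))
      · exact (abs_add_le _ _).trans (add_le_add (key 2) (hc 1))
      · exact (abs_add_le _ _).trans (add_le_add (key 3) (hc 2))
    · rw [pow_succ, he]
      simp only [Fin.sum_univ_four, Matrix.cons_val_zero, Matrix.cons_val_one, Matrix.cons_val]
      push_cast
      simp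
      linear_combination (c 3 : ℝ) * hu

open scoped Matrix.Norms.Elementwise in
theorem exists_auxiliary_polynomials {θ : ℝ} {u : Fin 4 → ℤ}
    (hu : θ ^ 4 = u 0 + u 1 * θ + u 2 * θ ^ 2 + u 3 * θ ^ 3) :
    ∃ C : ℕ, 1 ≤ C ∧ ∀ k : ℕ, 1 ≤ k → ∃ P Q : ℤ[X], (P ≠ 0 ∨ Q ≠ 0) ∧
      P.natDegree < 5 * k ∧ Q.natDegree < 5 * k ∧
      (∀ i, |P.coeff i| ≤ (C : ℤ) ^ k) ∧ (∀ i, |Q.coeff i| ≤ (C : ℤ) ^ k) ∧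
      ∀ i < 2 * k, (hasseDeriv i (P.map (Int.castRingHom ℝ)
        - Polynomial.C θ * Q.map (Int.castRingHom ℝ))).eval θ = 0 := by
  obtain ⟨K, hK, hpow⟩ := exists_pow_eq_sum hu
  choose c hc hce using hpow
  refine ⟨(2 ^ 10 * (2 * K) ^ 5) ^ 4, Nat.one_le_pow _ _ (by positivity), fun k hk => ?_⟩
  let A : Matrix (Fin (2 * k) × Fin 4) (Fin (5 * k) ⊕ Fin (5 * k)) ℤ := fun e v =>
    match v with
    | .inl j => ((j : ℕ).choose e.1 : ℤ) * c (j - e.1) e.2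
    | .inr j => -(((j : ℕ).choose e.1 : ℤ) * c (j - e.1 + 1) e.2)
  have hA : max 1 ‖A‖ ≤ ((2 * K) ^ (5 * k) : ℕ) := by
    have hnn : (1 : ℝ) ≤ ((2 * K) ^ (5 * k) : ℕ) := by
      exact_mod_cast Nat.one_le_pow _ _ (by omega)
    refine max_le hnn ?_
    rw [Matrix.norm_le_iff (by linarith)]
    have main : ∀ (j m i l : ℕ) (h4 : l < 4), j < 5 * k → m ≤ 5 * k →
        |((j.choose i : ℕ) : ℤ) * c m ⟨l, h4⟩| ≤ ((2 * K) ^ (5 * k) : ℕ) := by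
      intro j m i l h4 hj hm
      rw [abs_mul, Nat.abs_cast, mul_pow]
      push_cast
      have h1 : ((j.choose i : ℕ) : ℤ) ≤ 2 ^ (5 * k) := by
        exact_mod_cast (Nat.choose_le_two_pow _ _).trans (Nat.pow_le_pow_right (by norm_num) hj.le)
      have h2 : |c m ⟨l, h4⟩| ≤ (K : ℤ) ^ (5 * k) :=
        (hc m _).trans (pow_le_pow_right₀ (by exact_mod_cast hK) hm)
      exact mul_le_mul h1 h2 (abs_nonneg _) (by positivity)
    rintro ⟨i, l, hl⟩ (⟨j, hj⟩ | ⟨j, hj⟩)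
    · rw [Int.norm_eq_abs]
      exact_mod_cast main j (j - i) i l hl hj (by omega)
    · rw [Int.norm_eq_abs]
      have := main j (j - i + 1) i l hl hj (by omega)
      rw [← abs_neg] at this
      exact_mod_cast this
  obtain ⟨t, ht0, htA, htn⟩ := Int.Matrix.exists_ne_zero_int_vec_norm_le A
    (by simp only [Fintype.card_prod, Fintype.card_fin, Fintype.card_sum]; omega)
    (by simp only [Fintype.card_prod, Fintype.card_fin]; omega)
  have htb : ∀ v, |t v| ≤ (((2 ^ 10 * (2 * K) ^ 5) ^ 4 : ℕ) : ℤ) ^ k := by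
    have hexp : ((Fintype.card (Fin (2 * k) × Fin 4) : ℕ) : ℝ) /
        ((Fintype.card (Fin (5 * k) ⊕ Fin (5 * k)) : ℕ) -
          (Fintype.card (Fin (2 * k) × Fin 4) : ℕ)) = (4 : ℕ) := by
      simp only [Fintype.card_prod, Fintype.card_fin, Fintype.card_sum]
      have : (k : ℝ) ≠ 0 := by positivity
      push_cast
      field_simp
      norm_num
    rw [hexp, Real.rpow_natCast] at htn
    intro v
    have h1 : ‖t v‖ ≤ ‖t‖ := norm_le_pi_norm t v
    have h2 : (((Fintype.card (Fin (5 * k) ⊕ Fin (5 * k)) : ℕ) : ℝ) * max 1 ‖A‖) ^ 4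
        ≤ ((((2 : ℕ) ^ (10 * k) : ℕ) : ℝ) * ((2 * K) ^ (5 * k) : ℕ)) ^ 4 := by
      have h3 : Fintype.card (Fin (5 * k) ⊕ Fin (5 * k)) ≤ 2 ^ (10 * k) := by
        simp only [Fintype.card_fin, Fintype.card_sum]
        have := (Nat.lt_two_pow_self (n := 10 * k)).le
        omega
      have h3' : ((Fintype.card (Fin (5 * k) ⊕ Fin (5 * k)) : ℕ) : ℝ) ≤
          ((2 ^ (10 * k) : ℕ) : ℝ) := by
        exact_mod_cast h3
      gcongr
    have h4 := (h1.trans htn).trans h2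
    rw [Int.norm_eq_abs] at h4
    have h5 : |t v| ≤ ((2 : ℤ) ^ (10 * k) * (2 * K) ^ (5 * k)) ^ 4 := by exact_mod_cast h4
    refine h5.trans (le_of_eq ?_)
    push_cast
    rw [pow_mul, pow_mul (2 * (K : ℤ)), ← mul_pow, ← pow_mul, ← pow_mul, mul_comm k 4]
    norm_num
  let mk : (Fin (5 * k) → ℤ) → ℤ[X] := fun s => ∑ j : Fin (5 * k), monomial (j : ℕ) (s j)
  have mk_coeff : ∀ s i, (mk s).coeff i = if h : i < 5 * k then s ⟨i, h⟩ else 0 := by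
    intro s i
    simp only [mk, finsetSum_coeff, coeff_monomial]
    split_ifs with h
    · rw [Finset.sum_eq_single ⟨i, h⟩]
      · simp
      · intro b _ hb
        rw [if_neg]
        rintro rfl
        exact hb rfl
      · simp
    · refine Finset.sum_eq_zero fun j _ => ?_
      rw [if_neg]
      rintro rfl
      exact h j.2
  have mk_deg : ∀ s, (mk s).natDegree < 5 * k := by
    intro s
    have : (mk s).natDegree ≤ 5 * k - 1 := by
      rw [natDegree_le_iff_coeff_eq_zero]
      intro i hi
      rw [mk_coeff, dif_neg (by omega)]
    omega
  have mk_bound : ∀ s, (∀ j, |s j| ≤ (((2 ^ 10 * (2 * K) ^ 5) ^ 4 : ℕ) : ℤ) ^ k) →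
      ∀ i, |(mk s).coeff i| ≤ (((2 ^ 10 * (2 * K) ^ 5) ^ 4 : ℕ) : ℤ) ^ k := by
    intro s hs i
    rw [mk_coeff]
    split_ifs
    · exact hs _
    · rw [abs_zero]; positivity
  have mk_eval : ∀ s i, (hasseDeriv i ((mk s).map (Int.castRingHom ℝ))).eval θ
      = ∑ j : Fin (5 * k), ((j : ℕ).choose i : ℝ) * s j * θ ^ ((j : ℕ) - i) := by
    intro s i
    simp only [mk, Polynomial.map_sum, map_monomial, map_sum, hasseDeriv_monomial, eval_finsetSum,
      eval_monomial]
    simp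
  refine ⟨mk fun j => t (.inl j), mk fun j => t (.inr j), ?_, mk_deg _, mk_deg _,
    mk_bound _ fun j => htb _, mk_bound _ fun j => htb _, fun i hi => ?_⟩
  · by_contra! h
    apply ht0
    ext v
    rcases v with j | j
    · have := congrArg (fun p => p.coeff (j : ℕ)) h.1
      simpa [mk_coeff] using this
    · have := congrArg (fun p => p.coeff (j : ℕ)) h.2
      simpa [mk_coeff] using this
  · rw [← smul_eq_C_mul, map_sub, map_smul, eval_sub, eval_smul, mk_eval, mk_eval, smul_eq_mul]
    have hrow : ∀ l, (∑ j, (A (⟨i, hi⟩, l) (.inl j) : ℝ) * t (.inl j))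
        + ∑ j, (A (⟨i, hi⟩, l) (.inr j) : ℝ) * t (.inr j) = 0 := by
      intro l
      have h := congrFun htA (⟨i, hi⟩, l)
      simp only [Matrix.mulVec, dotProduct, Fintype.sum_sum_type, Pi.zero_apply] at h
      exact_mod_cast h
    calc _ = ∑ l : Fin 4, ((∑ j, (A (⟨i, hi⟩, l) (.inl j) : ℝ) * t (.inl j))
        + ∑ j, (A (⟨i, hi⟩, l) (.inr j) : ℝ) * t (.inr j)) * θ ^ (l : ℕ) := by
          simp only [add_mul, Finset.sum_mul, Finset.sum_add_distrib, Finset.mul_sum]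
          rw [Finset.sum_comm, Finset.sum_comm (s := (Finset.univ : Finset (Fin 4))),
            sub_eq_add_neg, ← Finset.sum_neg_distrib]
          congr 1
          · refine Finset.sum_congr rfl fun j _ => ?_
            rw [hce, Finset.mul_sum]
            refine Finset.sum_congr rfl fun l _ => ?_
            simp only [A]
            push_cast
            ring
          · refine Finset.sum_congr rfl fun j _ => ?_
            rw [show θ * (((j : ℕ).choose i : ℝ) * (t (.inr j) : ℝ) * θ ^ ((j : ℕ) - i))
              = ((j : ℕ).choose i : ℝ) * (t (.inr j) : ℝ) * θ ^ ((j : ℕ) - i + 1) by ring,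
              hce, Finset.mul_sum, ← Finset.sum_neg_distrib]
            refine Finset.sum_congr rfl fun l _ => ?_
            simp only [A]
            push_cast
            ring
      _ = 0 := by simp [hrow]

theorem exists_hasseDeriv_eval_ne_zero {P Q : ℤ[X]} (hW : wronskian P Q ≠ 0) {p₁ p₂ : ℤ}
    {q₁ q₂ : ℕ} (hq₁ : 0 < q₁) (hq₂ : 0 < q₂) (hpq₁ : IsCoprime p₁ (q₁ : ℤ)) :
    ∃ j, (q₁ : ℤ) ^ (j - 1) ≤ |(wronskian P Q).leadingCoeff| ∧
      (hasseDeriv j ((C (q₂ : ℤ) * P - C p₂ * Q).map (Int.castRingHom ℚ))).eval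
        ((p₁ : ℚ) / q₁) ≠ 0 := by
  classical
  set T : ℤ[X] := C (q₂ : ℤ) * P - C p₂ * Q with hT
  have hTW : C (q₂ : ℤ) * wronskian P Q = T * derivative Q - derivative T * Q := by
    simp only [hT, wronskian, derivative_sub, derivative_mul, derivative_C]; ring
  have hq₂' : C (q₂ : ℤ) ≠ 0 := by
    rw [Ne, C_eq_zero]; exact_mod_cast hq₂.ne'
  have hT0 : T ≠ 0 := by
    intro h
    rw [h] at hTW
    simp at hTW
    exact hTW.elim (fun h => hq₂.ne' h) hW
  set x : ℚ := (p₁ : ℚ) / q₁ with hx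
  have hTm : T.map (Int.castRingHom ℚ) ≠ 0 := by
    rwa [Ne, Polynomial.map_eq_zero_iff (Int.cast_injective)]
  have hex : ∃ j, (hasseDeriv j (T.map (Int.castRingHom ℚ))).eval x ≠ 0 := by
    by_contra! h
    apply hTm
    apply taylor_injective x
    ext i
    rw [taylor_coeff, h]
    simp
  refine ⟨Nat.find hex, ?_, Nat.find_spec hex⟩
  set j := Nat.find hex
  have hdvd : (X - C x) ^ j ∣ T.map (Int.castRingHom ℚ) := by
    rw [X_sub_C_pow_dvd_iff, ← taylor_apply, X_pow_dvd_iff]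
    intro d hd
    rw [taylor_coeff]
    exact not_not.mp (Nat.find_min hex hd)
  refine pow_le_abs_leadingCoeff_of_pow_dvd hq₁ hpq₁ (j - 1) _ hW ?_
  have hu : IsUnit (C (q₂ : ℚ)) := by
    rw [isUnit_C, isUnit_iff_ne_zero]; exact_mod_cast hq₂.ne'
  rw [← hu.dvd_mul_left]
  have hmap := congrArg (Polynomial.map (Int.castRingHom ℚ)) hTW
  simp only [Polynomial.map_mul, Polynomial.map_sub, map_C, ← derivative_map] at hmap
  have hc : (Int.castRingHom ℚ) (q₂ : ℤ) = (q₂ : ℚ) := by simp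
  rw [hc] at hmap
  rw [hmap]
  exact dvd_sub (((pow_dvd_pow _ (Nat.sub_le _ _)).trans hdvd).mul_right _)
    ((pow_sub_one_dvd_derivative_of_pow_dvd hdvd).mul_right _)

theorem one_le_pow_mul_abs_eval {T : ℤ[X]} {N : ℕ} (hT : T.natDegree ≤ N) {p : ℤ} {q : ℕ}
    (hq : 0 < q) (h : (T.map (Int.castRingHom ℝ)).eval ((p : ℝ) / q) ≠ 0) :
    1 ≤ (q : ℝ) ^ N * |(T.map (Int.castRingHom ℝ)).eval ((p : ℝ) / q)| := by
  have hq' : (q : ℝ) ≠ 0 := by positivity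
  have he : (q : ℝ) ^ N * (T.map (Int.castRingHom ℝ)).eval ((p : ℝ) / q)
      = ((∑ i ∈ Finset.range (N + 1), T.coeff i * p ^ i * q ^ (N - i) : ℤ) : ℝ) := by
    rw [eval_eq_sum_range' (Nat.lt_succ_of_le (natDegree_map_le.trans hT)), Finset.mul_sum]
    push_cast
    refine Finset.sum_congr rfl fun i hi => ?_
    have : (q : ℝ) ^ N = q ^ (N - i) * q ^ i := by
      rw [← pow_add, Nat.sub_add_cancel (Finset.mem_range_succ_iff.mp hi)]
    rw [this, coeff_map, div_pow]
    simp
    field_simp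
  rw [← abs_of_nonneg (by positivity : (0 : ℝ) ≤ (q : ℝ) ^ N), ← abs_mul, he]
  have hne : (q : ℝ) ^ N * (T.map (Int.castRingHom ℝ)).eval ((p : ℝ) / q) ≠ 0 :=
    mul_ne_zero (pow_ne_zero _ hq') h
  rw [he] at hne
  exact_mod_cast Int.one_le_abs (by exact_mod_cast hne)

theorem abs_coeff_mul_derivative_le {P Q : ℤ[X]} {N : ℕ} {B : ℤ} (hQ : Q.natDegree < N)
    (hPB : ∀ i, |P.coeff i| ≤ B) (hQB : ∀ i, |Q.coeff i| ≤ B) (m : ℕ) :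
    |(P * derivative Q).coeff m| ≤ (m + 1) * (B * (B * N)) := by
  have hB : 0 ≤ B := (abs_nonneg _).trans (hPB 0)
  rw [coeff_mul]
  refine (Finset.abs_sum_le_sum_abs _ _).trans ?_
  calc _ ≤ ∑ _x ∈ Finset.HasAntidiagonal.antidiagonal m, B * (B * N) := by
        refine Finset.sum_le_sum fun x _ => ?_
        rw [abs_mul, coeff_derivative, abs_mul]
        by_cases hx : x.2 + 1 < N
        · have h1 : |(x.2 : ℤ) + 1| ≤ N := by
            rw [abs_of_nonneg (by positivity)]; exact_mod_cast hx.le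
          gcongr
          · exact hPB _
          · exact hQB _
        · rw [coeff_eq_zero_of_natDegree_lt (p := Q) (by omega)]
          simp only [abs_zero, zero_mul, mul_zero]
          positivity
    _ = _ := by simp

theorem abs_leadingCoeff_wronskian_le {P Q : ℤ[X]} {N : ℕ} {B : ℤ} (hW : wronskian P Q ≠ 0)
    (hP : P.natDegree < N) (hQ : Q.natDegree < N)
    (hPB : ∀ i, |P.coeff i| ≤ B) (hQB : ∀ i, |Q.coeff i| ≤ B) :
    |(wronskian P Q).leadingCoeff| ≤ 4 * N ^ 2 * B ^ 2 := by
  have hB : 0 ≤ B := (abs_nonneg _).trans (hPB 0)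
  have hm := natDegree_wronskian_lt_add hW
  set m := (wronskian P Q).natDegree with hmdef
  rw [leadingCoeff, ← hmdef, wronskian, coeff_sub, mul_comm (derivative P)]
  have h1 := abs_coeff_mul_derivative_le hQ hPB hQB m
  have h2 := abs_coeff_mul_derivative_le hP hQB hPB m
  have h3 : ((m : ℤ) + 1) ≤ 2 * N := by omega
  have h4 : ((m : ℤ) + 1) * (B * (B * N)) ≤ 2 * N * (B * (B * N)) := by gcongr
  calc _ ≤ _ := abs_sub _ _
    _ ≤ 2 * N * (B * (B * N)) + 2 * N * (B * (B * N)) := add_le_add (h1.trans h4) (h2.trans h4)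
    _ = _ := by ring

theorem hasseDeriv_map' {R S : Type*} [CommRing R] [CommRing S] (f : R →+* S) (P : R[X]) (j : ℕ) :
    hasseDeriv j (P.map f) = (hasseDeriv j P).map f := by
  ext i
  simp [hasseDeriv_coeff]

theorem one_le_of_two_approximations {θ : ℝ} (hθ : IsIntegral ℚ θ)
    (hdeg : (minpoly ℚ θ).natDegree = 4) {u : Fin 4 → ℤ}
    (hu : θ ^ 4 = u 0 + u 1 * θ + u 2 * θ ^ 2 + u 3 * θ ^ 3) :
    ∃ H : ℕ, 2 ≤ H ∧ ∀ k : ℕ, 1 ≤ k → ∀ (p₁ p₂ : ℤ) (q₁ q₂ : ℕ), 0 < q₁ → 0 < q₂ →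
      IsCoprime p₁ (q₁ : ℤ) → |p₁ / q₁ - θ| ≤ 1 → ∃ j, q₁ ^ (j - 1) ≤ H ^ k ∧
      (1 : ℝ) ≤ q₁ ^ (5 * k) * (H ^ k * q₂ *
        (|p₁ / q₁ - θ| ^ (2 * k - j) + |p₂ / q₂ - θ|)) := by
  obtain ⟨C', hC', haux⟩ := exists_auxiliary_polynomials hu
  obtain ⟨M, hM⟩ := exists_nat_ge (1 + |θ|)
  have hM1 : (1 : ℝ) ≤ M := by linarith [abs_nonneg θ]
  have hM1' : 1 ≤ M := by exact_mod_cast hM1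
  refine ⟨2 ^ 20 * C' ^ 2 * M ^ 6, ?_, ?_⟩
  · have h1 : 1 ≤ C' ^ 2 := Nat.one_le_pow _ _ hC'
    have h2 : 1 ≤ M ^ 6 := Nat.one_le_pow _ _ hM1'
    nlinarith [Nat.mul_le_mul h1 h2]
  intro k hk p₁ p₂ q₁ q₂ hq₁ hq₂ hcop hclose
  obtain ⟨P, Q, hPQ, hP, hQ, hPB, hQB, hv⟩ := haux k hk
  have hk2 : 5 * k ≤ 2 ^ (5 * k) := Nat.lt_two_pow_self.le
  set g : ℝ[X] := P.map (Int.castRingHom ℝ) - Polynomial.C θ * Q.map (Int.castRingHom ℝ) with hg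
  have hdvd : (X - Polynomial.C θ) ^ (2 * k) ∣ g := by
    rw [X_sub_C_pow_dvd_iff, ← taylor_apply, X_pow_dvd_iff]
    intro d hd
    rw [taylor_coeff]
    exact hv d hd
  have hW : wronskian P Q ≠ 0 := by
    intro h0
    have hinj : Function.Injective (Int.castRingHom ℚ) := Int.cast_injective
    refine wronskian_ne_zero_of_pow_dvd hθ hdeg (n := 2 * k) (N := 5 * k) (by omega)
      (P := P.map (Int.castRingHom ℚ)) (Q := Q.map (Int.castRingHom ℚ)) ?_
      (lt_of_le_of_lt natDegree_map_le hP) (lt_of_le_of_lt natDegree_map_le hQ) ?_ ?_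
    · simpa [Polynomial.map_eq_zero_iff hinj] using hPQ
    · rw [Polynomial.map_map, Polynomial.map_map]
      have : (algebraMap ℚ ℝ).comp (Int.castRingHom ℚ) = Int.castRingHom ℝ := RingHom.ext_int _ _
      rw [this]
      exact hdvd
    · have := congrArg (Polynomial.map (Int.castRingHom ℚ)) h0
      simpa [wronskian, derivative_map] using this
  obtain ⟨j, hj, hne⟩ := exists_hasseDeriv_eval_ne_zero hW (p₂ := p₂) hq₁ hq₂ hcop
  refine ⟨j, ?_, ?_⟩
  · have h1 := hj.trans (abs_leadingCoeff_wronskian_le hW hP hQ hPB hQB)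
    have h2 : q₁ ^ (j - 1) ≤ 4 * (5 * k) ^ 2 * (C' ^ k) ^ 2 := by exact_mod_cast h1
    refine h2.trans ?_
    calc 4 * (5 * k) ^ 2 * (C' ^ k) ^ 2 ≤ 4 ^ k * (2 ^ (5 * k)) ^ 2 * (C' ^ k) ^ 2 := by
          gcongr
          exact Nat.le_self_pow (by omega) 4
      _ = (2 ^ 12 * C' ^ 2) ^ k := by
          rw [mul_pow, ← pow_mul, ← pow_mul, ← pow_mul, show 4 = 2 ^ 2 by norm_num, ← pow_mul,
            ← pow_mul, ← pow_add]
          ring_nf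
      _ ≤ (2 ^ 20 * C' ^ 2 * M ^ 6) ^ k := by
          apply Nat.pow_le_pow_left
          calc 2 ^ 12 * C' ^ 2 ≤ 2 ^ 20 * C' ^ 2 := by gcongr <;> norm_num
            _ ≤ _ := Nat.le_mul_of_pos_right _ (by positivity)
  · set T : ℤ[X] := C (q₂ : ℤ) * P - C p₂ * Q with hT
    set x : ℝ := (p₁ : ℝ) / q₁ with hx
    have hTdeg : T.natDegree < 5 * k := by
      refine lt_of_le_of_lt (natDegree_sub_le _ _) (max_lt ?_ ?_)
      · exact lt_of_le_of_lt (natDegree_C_mul_le _ _) hP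
      · exact lt_of_le_of_lt (natDegree_C_mul_le _ _) hQ
    have hne' : ((hasseDeriv j T).map (Int.castRingHom ℝ)).eval x ≠ 0 := by
      intro h
      apply hne
      have hcomp : (algebraMap ℚ ℝ).comp (Int.castRingHom ℚ) = Int.castRingHom ℝ :=
        RingHom.ext_int _ _
      have hxq : x = algebraMap ℚ ℝ ((p₁ : ℚ) / q₁) := by simp [hx]
      rw [← hcomp, ← Polynomial.map_map, hxq, eval_map_apply] at h
      rw [hasseDeriv_map']
      exact (map_eq_zero_iff _ (algebraMap ℚ ℝ).injective).mp h
    have hlow := one_le_pow_mul_abs_eval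
      (((natDegree_hasseDeriv_le T j).trans (Nat.sub_le _ _)).trans hTdeg.le) hq₁ hne'
    refine hlow.trans ?_
    have hq₂' : (q₂ : ℝ) ≠ 0 := by positivity
    have hsplit : (hasseDeriv j T).map (Int.castRingHom ℝ)
        = (q₂ : ℝ) • (hasseDeriv j g - (p₂ / q₂ - θ) •
            hasseDeriv j (Q.map (Int.castRingHom ℝ))) := by
      rw [← hasseDeriv_map', ← map_smul, ← map_sub, ← map_smul]
      congr 1
      simp only [hT, hg, Polynomial.map_sub, Polynomial.map_mul, map_C, smul_eq_C_mul, mul_sub,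
        sub_mul, ← mul_assoc, ← C_mul, C_sub, mul_div_cancel₀ _ hq₂']
      simp
    have hQR : (Q.map (Int.castRingHom ℝ)).natDegree < 5 * k :=
      lt_of_le_of_lt natDegree_map_le hQ
    have hPR : (P.map (Int.castRingHom ℝ)).natDegree < 5 * k :=
      lt_of_le_of_lt natDegree_map_le hP
    have hgdeg : g.natDegree < 5 * k :=
      lt_of_le_of_lt (natDegree_sub_le _ _)
        (max_lt hPR (lt_of_le_of_lt (natDegree_C_mul_le _ _) hQR))
    have hQB' : ∀ i, |(Q.map (Int.castRingHom ℝ)).coeff i| ≤ (C' : ℝ) ^ k := by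
      intro i; rw [coeff_map]; simp only [eq_intCast]; exact_mod_cast hQB i
    have hPB' : ∀ i, |(P.map (Int.castRingHom ℝ)).coeff i| ≤ (C' : ℝ) ^ k := by
      intro i; rw [coeff_map]; simp only [eq_intCast]; exact_mod_cast hPB i
    have hgB : ∀ i, |g.coeff i| ≤ (C' : ℝ) ^ k * M := by
      intro i
      rw [hg, coeff_sub, coeff_C_mul]
      calc _ ≤ _ := abs_sub _ _
        _ ≤ (C' : ℝ) ^ k + |θ| * (C' : ℝ) ^ k := by
          rw [abs_mul]
          exact add_le_add (hPB' i) (mul_le_mul_of_nonneg_left (hQB' i) (abs_nonneg _))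
        _ = (C' : ℝ) ^ k * (1 + |θ|) := by ring
        _ ≤ _ := by gcongr
    have hxM : |x| ≤ M := by
      calc |x| = |(x - θ) + θ| := by ring_nf
        _ ≤ |x - θ| + |θ| := abs_add_le _ _
        _ ≤ M := by linarith
    have b1 := abs_eval_hasseDeriv_le_of_vanish hgdeg hgB hM1 (by linarith) hv hclose j
    have b2 := abs_eval_hasseDeriv_le hQR hQB' hM1 hxM j
    have hC1 : (1 : ℝ) ≤ C' := by exact_mod_cast hC'
    have hN : (((5 * k : ℕ) : ℕ) : ℝ) ≤ 2 ^ (5 * k) := by exact_mod_cast hk2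
    have hH1 : ((5 * k : ℕ) : ℝ) * (2 ^ (5 * k) * (((5 * k : ℕ) : ℝ) *
        (2 ^ (5 * k) * ((C' : ℝ) ^ k * M) * M ^ (5 * k))))
        ≤ ((2 ^ 20 * C' ^ 2 * M ^ 6 : ℕ) : ℝ) ^ k := by
      calc _ ≤ (2 : ℝ) ^ (5 * k) * (2 ^ (5 * k) * (2 ^ (5 * k) *
        (2 ^ (5 * k) * (((C' : ℝ) ^ 2) ^ k * M ^ k) * M ^ (5 * k)))) := by
            gcongr
            · exact le_self_pow₀ hC1 (by norm_num)
            · exact le_self_pow₀ hM1 (by omega)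
        _ = _ := by
          push_cast
          simp only [mul_pow, ← pow_mul]
          rw [show (M : ℝ) ^ (6 * k) = M ^ k * M ^ (5 * k) by ring,
            show (1048576 : ℝ) = 2 ^ 20 by norm_num, ← pow_mul,
            show (2 : ℝ) ^ (20 * k) = 2 ^ (5 * k) * 2 ^ (5 * k) * 2 ^ (5 * k) * 2 ^ (5 * k) by ring]
          ring
    have hH2 : ((5 * k : ℕ) : ℝ) * (2 ^ (5 * k) * (C' : ℝ) ^ k * M ^ (5 * k))
        ≤ ((2 ^ 20 * C' ^ 2 * M ^ 6 : ℕ) : ℝ) ^ k := by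
      refine le_trans ?_ hH1
      have e1 : (1 : ℝ) ≤ 2 ^ (5 * k) := one_le_pow₀ (by norm_num)
      have e2 : (1 : ℝ) ≤ ((5 * k : ℕ) : ℝ) := by exact_mod_cast (by omega : 1 ≤ 5 * k)
      have e3 : (1 : ℝ) ≤ 2 ^ (5 * k) * ((5 * k : ℕ) : ℝ) := one_le_mul_of_one_le_of_one_le e1 e2
      calc _ = ((5 * k : ℕ) : ℝ) * (1 * (2 ^ (5 * k) * ((C' : ℝ) ^ k * 1) * M ^ (5 * k))) := by ring
        _ ≤ ((5 * k : ℕ) : ℝ) * ((2 ^ (5 * k) * ((5 * k : ℕ) : ℝ)) *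
              (2 ^ (5 * k) * ((C' : ℝ) ^ k * M) * M ^ (5 * k))) := by gcongr
        _ = _ := by ring
    rw [hsplit, eval_smul, eval_sub, eval_smul, smul_eq_mul, smul_eq_mul, abs_mul, Nat.abs_cast]
    set HH : ℝ := ((2 ^ 20 * C' ^ 2 * M ^ 6 : ℕ) : ℝ) ^ k
    have hHH : 0 ≤ HH := by positivity
    have hfin : |eval x (hasseDeriv j g) - (p₂ / q₂ - θ) *
        eval x (hasseDeriv j (Q.map (Int.castRingHom ℝ)))|
        ≤ HH * (|x - θ| ^ (2 * k - j) + |p₂ / q₂ - θ|) := by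
      calc _ ≤ _ := abs_sub _ _
        _ ≤ HH * |x - θ| ^ (2 * k - j) + |p₂ / q₂ - θ| * HH := by
          rw [abs_mul]
          refine add_le_add (b1.trans ?_) ?_
          · exact mul_le_mul_of_nonneg_right hH1 (by positivity)
          · exact mul_le_mul_of_nonneg_left (b2.trans hH2) (abs_nonneg _)
        _ = _ := by ring
    calc _ ≤ (q₁ : ℝ) ^ (5 * k) * (q₂ * (HH * (|x - θ| ^ (2 * k - j) + |p₂ / q₂ - θ|))) := by
          gcongr
      _ = _ := by ring

theorem thue_quartic {θ : ℝ} (hθ : IsIntegral ℚ θ)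
    (hdeg : (minpoly ℚ θ).natDegree = 4) {u : Fin 4 → ℤ}
    (hu : θ ^ 4 = u 0 + u 1 * θ + u 2 * θ ^ 2 + u 3 * θ ^ 3) (D : ℕ) :
    ∃ q₀ : ℕ, ∀ (p : ℤ) (q : ℕ), IsCoprime p (q : ℤ) → |p / q - θ| * (q : ℝ) ^ 4 ≤ D → q < q₀ := by
  obtain ⟨H, hH, hmain⟩ := one_le_of_two_approximations hθ hdeg hu
  by_contra! hcon
  set D' := D + 1 with hD'
  have hD1 : 1 ≤ D' := by omega
  set E := 4 * H * D' ^ 2 with hE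
  have hE2 : 2 ≤ E := by
    have : 1 ≤ D' ^ 2 := Nat.one_le_pow _ _ hD1
    nlinarith
  have hEH : H ≤ E := by
    have : 1 ≤ D' ^ 2 := Nat.one_le_pow _ _ hD1
    nlinarith
  have hED : D' ≤ E := by
    have : D' ≤ D' ^ 2 := Nat.le_self_pow (by norm_num) _
    nlinarith
  obtain ⟨p₁, q₁, hcop₁, happ₁, hq₁⟩ := hcon (E ^ 20)
  obtain ⟨p₂, q₂, -, happ₂, hq₂⟩ := hcon (q₁ ^ 40)
  have hEq : E ≤ q₁ := (Nat.le_self_pow (by norm_num) E).trans hq₁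
  have hq₁2 : 2 ≤ q₁ := hE2.trans hEq
  have hq₁0 : 0 < q₁ := by omega
  have hq₂0 : 0 < q₂ := lt_of_lt_of_le (by positivity) hq₂
  set k := Nat.log q₁ q₂ / 2 with hk
  have hlog : 40 ≤ Nat.log q₁ q₂ := Nat.le_log_of_pow_le (by omega) hq₂
  have hk20 : 20 ≤ k := by omega
  have hlo : q₁ ^ (2 * k) ≤ q₂ :=
    (Nat.pow_le_pow_right hq₁0 (by omega)).trans (Nat.pow_log_le_self q₁ hq₂0.ne')
  have hhi : q₂ < q₁ ^ (2 * k + 2) :=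
    (Nat.lt_pow_succ_log_self (by omega) q₂).trans_le (Nat.pow_le_pow_right hq₁0 (by omega))
  have hq₁R : (1 : ℝ) ≤ q₁ := by exact_mod_cast hq₁0
  have hclose : ∀ (p : ℤ) (q : ℕ), 0 < q → |p / q - θ| * (q : ℝ) ^ 4 ≤ D →
      |p / q - θ| ≤ D' / (q : ℝ) ^ 4 := by
    intro p q hq h
    rw [le_div_iff₀ (by positivity)]
    refine h.trans ?_
    simp [hD']
  have h1 := hclose p₁ q₁ hq₁0 happ₁
  have h2 := hclose p₂ q₂ hq₂0 happ₂
  have hone : |p₁ / q₁ - θ| ≤ 1 := by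
    refine h1.trans ?_
    rw [div_le_one (by positivity)]
    calc (D' : ℝ) ≤ q₁ := by exact_mod_cast hED.trans hEq
      _ ≤ (q₁ : ℝ) ^ 4 := le_self_pow₀ hq₁R (by norm_num)
  obtain ⟨j, hj, hineq⟩ := hmain k (by omega) p₁ p₂ q₁ q₂ hq₁0 hq₂0 hcop₁ hone
  have hj20 : 20 * (j - 1) ≤ k := by
    by_contra! hlt
    have : E ^ (20 * (j - 1)) ≤ E ^ k := by
      calc E ^ (20 * (j - 1)) = (E ^ 20) ^ (j - 1) := by rw [pow_mul]
        _ ≤ q₁ ^ (j - 1) := Nat.pow_le_pow_left hq₁ _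
        _ ≤ H ^ k := hj
        _ ≤ E ^ k := Nat.pow_le_pow_left hEH _
    exact absurd ((Nat.pow_le_pow_iff_right (by omega)).mp this) (by omega)
  set m := k / 20 + 1 with hm
  have hEk : E ^ k ≤ q₁ ^ m := by
    calc E ^ k ≤ E ^ (20 * m) := Nat.pow_le_pow_right (by omega) (by omega)
      _ = (E ^ 20) ^ m := by rw [pow_mul]
      _ ≤ _ := Nat.pow_le_pow_left hq₁ _
  have hEk' : 4 * (H : ℝ) ^ k * (D' : ℝ) ^ (2 * k) ≤ (q₁ : ℝ) ^ m := by
    have : 4 * H ^ k * D' ^ (2 * k) ≤ q₁ ^ m := by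
      refine le_trans ?_ hEk
      rw [hE, mul_pow, mul_pow, ← pow_mul]
      gcongr
      exact Nat.le_self_pow (by omega) 4
    exact_mod_cast this
  have hD1R : (1 : ℝ) ≤ D' := by exact_mod_cast hD1
  have hhiR : (q₂ : ℝ) ≤ (q₁ : ℝ) ^ (2 * k + 2) := by exact_mod_cast hhi.le
  have hloR : (q₁ : ℝ) ^ (2 * k) ≤ q₂ := by exact_mod_cast hlo
  have hA : 4 * ((q₁ : ℝ) ^ (5 * k) * (H ^ k * q₂ * |p₁ / q₁ - θ| ^ (2 * k - j))) ≤ 1 := by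
    calc _ ≤ 4 * ((q₁ : ℝ) ^ (5 * k) * (H ^ k * (q₁ : ℝ) ^ (2 * k + 2) *
          (D' / (q₁ : ℝ) ^ 4) ^ (2 * k - j))) := by gcongr
      _ = (q₁ : ℝ) ^ (7 * k + 2) * (4 * H ^ k * (D' : ℝ) ^ (2 * k - j)) /
          (q₁ : ℝ) ^ (4 * (2 * k - j)) := by
        rw [div_pow, ← pow_mul]; ring
      _ ≤ (q₁ : ℝ) ^ (7 * k + 2) * (q₁ : ℝ) ^ m / (q₁ : ℝ) ^ (4 * (2 * k - j)) := by
        gcongr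
        refine le_trans ?_ hEk'
        gcongr
        omega
      _ ≤ 1 := by
        rw [div_le_one (by positivity), ← pow_add]
        exact pow_le_pow_right₀ hq₁R (by omega)
  have hB : 4 * ((q₁ : ℝ) ^ (5 * k) * (H ^ k * q₂ * |p₂ / q₂ - θ|)) ≤ 1 := by
    calc _ ≤ 4 * ((q₁ : ℝ) ^ (5 * k) * (H ^ k * q₂ * (D' / (q₂ : ℝ) ^ 4))) := by gcongr
      _ = (q₁ : ℝ) ^ (5 * k) * (4 * H ^ k * D') / (q₂ : ℝ) ^ 3 := by
        field_simp
      _ ≤ (q₁ : ℝ) ^ (5 * k) * (q₁ : ℝ) ^ m / ((q₁ : ℝ) ^ (2 * k)) ^ 3 := by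
        gcongr
        refine le_trans ?_ hEk'
        gcongr
        exact le_self_pow₀ hD1R (by omega)
      _ ≤ 1 := by
        rw [div_le_one (by positivity), ← pow_add, ← pow_mul]
        exact pow_le_pow_right₀ hq₁R (by omega)
  have : (q₁ : ℝ) ^ (5 * k) * (H ^ k * q₂ * (|p₁ / q₁ - θ| ^ (2 * k - j) + |p₂ / q₂ - θ|))
      = (q₁ : ℝ) ^ (5 * k) * (H ^ k * q₂ * |p₁ / q₁ - θ| ^ (2 * k - j)) +
        (q₁ : ℝ) ^ (5 * k) * (H ^ k * q₂ * |p₂ / q₂ - θ|) := by ring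
  linarith

theorem exists_bound_of_approximation {θ : ℝ} {c₂ c₁ c₀ : ℤ}
    (hroot : θ ^ 4 + c₂ * θ ^ 2 + c₁ * θ + c₀ = 0) (D : ℕ) :
    ∃ q₀ : ℕ, ∀ (p : ℤ) (q : ℕ), 0 < q →
      p ^ 4 + c₂ * p ^ 2 * q ^ 2 + c₁ * p * q ^ 3 + c₀ * q ^ 4 = 1 →
      |p / q - θ| * (q : ℝ) ^ 4 ≤ D → q < q₀ := by
  set f : ℤ[X] := X ^ 4 + (C c₂ * X ^ 2 + C c₁ * X + C c₀) with hf
  have hlow : (C c₂ * X ^ 2 + C c₁ * X + C c₀ : ℤ[X]).degree < ((4 : ℕ) : WithBot ℕ) :=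
    lt_of_le_of_lt degree_quadratic_le (by norm_num)
  have hmonic : f.Monic := monic_X_pow_add hlow
  have hfdeg : f.natDegree = 4 := natDegree_eq_of_degree_eq_some (by
    rw [hf, degree_add_eq_left_of_degree_lt (by rwa [degree_X_pow]), degree_X_pow])
  have hfθ : aeval θ f = 0 := by
    simp [hf]; linarith
  have hθℤ : IsIntegral ℤ θ := ⟨f, hmonic, by rw [← aeval_def]; exact hfθ⟩
  have hθℚ : IsIntegral ℚ θ := hθℤ.tower_top
  have hmin : minpoly ℚ θ = (minpoly ℤ θ).map (algebraMap ℤ ℚ) :=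
    minpoly.isIntegrallyClosed_eq_field_fractions' ℚ hθℤ
  have hdvd : minpoly ℤ θ ∣ f := minpoly.isIntegrallyClosed_dvd hθℤ hfθ
  have hmm : (minpoly ℤ θ).Monic := minpoly.monic hθℤ
  have hle : (minpoly ℤ θ).natDegree ≤ 4 := hfdeg ▸ natDegree_le_of_dvd hdvd hmonic.ne_zero
  rcases hle.eq_or_lt with h4 | h3
  · have hdeg : (minpoly ℚ θ).natDegree = 4 := by
      rw [hmin, hmm.natDegree_map, h4]
    obtain ⟨q₀, hq₀⟩ := thue_quartic hθℚ hdeg (u := ![-c₀, -c₁, -c₂, 0])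
      (by simp; linarith) D
    refine ⟨q₀, fun p q _ hpq happ => hq₀ p q ?_ happ⟩
    refine ⟨p ^ 3 + c₂ * p * q ^ 2 + c₁ * q ^ 3, c₀ * q ^ 3, ?_⟩
    linear_combination hpq
  · set g := (minpoly ℤ θ).map (Int.castRingHom ℝ) with hg
    have hgθ : (X - C θ) ∣ g := by
      rw [dvd_iff_isRoot, IsRoot, hg]
      have := minpoly.aeval ℤ θ
      rwa [aeval_def, ← eval_map] at this
    obtain ⟨h, hh⟩ := hgθ
    obtain ⟨L, hL⟩ := (isCompact_Icc (a := θ - 1) (b := θ + 1)).exists_bound_of_continuousOn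
      (f := fun t => h.eval t) h.continuous.continuousOn
    obtain ⟨L', hL'⟩ := exists_nat_ge L
    refine ⟨D * (L' + 1) + 1, fun p q hq hpq happ => ?_⟩
    have hqR : (1 : ℝ) ≤ q := by exact_mod_cast hq
    have hq0 : (q : ℝ) ≠ 0 := by positivity
    by_cases hone : |p / q - θ| ≤ 1
    · have hne : g.eval ((p : ℝ) / q) ≠ 0 := by
        intro h0
        obtain ⟨r, hr⟩ := hdvd
        have h1 : (f.map (Int.castRingHom ℝ)).eval ((p : ℝ) / q) = 0 := by
          rw [hr, Polynomial.map_mul, eval_mul, ← hg, h0, zero_mul]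
        have h2 : (p : ℝ) ^ 4 + c₂ * p ^ 2 * q ^ 2 + c₁ * p * q ^ 3 + c₀ * q ^ 4 = 1 := by
          exact_mod_cast hpq
        simp [hf] at h1
        field_simp at h1
        have : (q : ℝ) ^ 4 ≠ 0 := by positivity
        nlinarith
      have hlo := one_le_pow_mul_abs_eval (N := 3) (by omega) hq hne
      rw [← hg, hh, eval_mul, abs_mul] at hlo
      simp only [eval_sub, eval_X, eval_C] at hlo
      have hLb : |h.eval ((p : ℝ) / q)| ≤ L' := by
        refine (hL _ ?_).trans hL'
        rw [abs_le] at hone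
        constructor <;> linarith [hone.1, hone.2]
      have h5 : (q : ℝ) ≤ D * L' := by
        calc (q : ℝ) = q * 1 := by ring
          _ ≤ q * ((q : ℝ) ^ 3 * (|(p : ℝ) / q - θ| * |h.eval ((p : ℝ) / q)|)) := by gcongr
          _ = (|(p : ℝ) / q - θ| * (q : ℝ) ^ 4) * |h.eval ((p : ℝ) / q)| := by ring
          _ ≤ D * L' := by gcongr
      have h6 : q ≤ D * L' := by exact_mod_cast h5
      nlinarith
    · have h5 : (q : ℝ) ≤ D := by
        calc (q : ℝ) ≤ (q : ℝ) ^ 4 := le_self_pow₀ hqR (by norm_num)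
          _ = 1 * (q : ℝ) ^ 4 := by ring
          _ ≤ |p / q - θ| * (q : ℝ) ^ 4 := by
            have := (not_le.mp hone).le
            gcongr
          _ ≤ D := happ
      have h6 : q ≤ D := by exact_mod_cast h5
      nlinarith [Nat.zero_le (D * L')]

theorem finite_quartic_eq_one {c₂ c₁ c₀ : ℤ}
    (hsep : ∀ θ : ℝ, θ ^ 4 + c₂ * θ ^ 2 + c₁ * θ + c₀ = 0 → 4 * θ ^ 3 + 2 * c₂ * θ + c₁ ≠ 0) :
    {v : ℤ × ℤ |
      v.1 ^ 4 + c₂ * v.1 ^ 2 * v.2 ^ 2 + c₁ * v.1 * v.2 ^ 3 + c₀ * v.2 ^ 4 = 1}.Finite := by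
  set R : ℤ := 1 + |c₂| + |c₁| + |c₀| with hR
  have hR1 : 1 ≤ R := by
    have h2 := abs_nonneg c₂
    have h1 := abs_nonneg c₁
    have h0 := abs_nonneg c₀
    omega
  -- a solution has `|p| ≤ R * max 1 |q|`
  have hsize : ∀ p q : ℤ, p ^ 4 + c₂ * p ^ 2 * q ^ 2 + c₁ * p * q ^ 3 + c₀ * q ^ 4 = 1 →
      |p| ≤ R * max 1 |q| := by
    intro p q h
    by_contra! hlt
    set m := max 1 |q| with hm
    have hm1 : 1 ≤ m := le_max_left _ _
    have hqm : |q| ≤ m := le_max_right _ _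
    have hp1 : R * m + 1 ≤ |p| := hlt
    have hmp : m ≤ |p| := by nlinarith
    have h1 : |p| ^ 4 ≤ (1 + |c₂| + |c₁| + |c₀|) * (m * |p| ^ 3) := by
      have e : p ^ 4 = 1 - c₂ * p ^ 2 * q ^ 2 - c₁ * p * q ^ 3 - c₀ * q ^ 4 := by linarith
      have a0 : (1 : ℤ) ≤ m * |p| ^ 3 := by
        have : 1 ≤ |p| := hm1.trans hmp
        have := one_le_pow₀ this (n := 3)
        nlinarith
      have a2 : |p| ^ 2 * |q| ^ 2 ≤ m * |p| ^ 3 := by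
        calc |p| ^ 2 * |q| ^ 2 ≤ |p| ^ 2 * m ^ 2 := by gcongr
          _ = m * (|p| ^ 2 * m) := by ring
          _ ≤ m * (|p| ^ 2 * |p|) := by gcongr
          _ = _ := by ring
      have a3 : |p| * |q| ^ 3 ≤ m * |p| ^ 3 := by
        calc |p| * |q| ^ 3 ≤ |p| * m ^ 3 := by gcongr
          _ = m * (|p| * m ^ 2) := by ring
          _ ≤ m * (|p| * |p| ^ 2) := by gcongr
          _ = _ := by ring
      have a4 : |q| ^ 4 ≤ m * |p| ^ 3 := by
        calc |q| ^ 4 ≤ m ^ 4 := by gcongr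
          _ = m * m ^ 3 := by ring
          _ ≤ m * |p| ^ 3 := by gcongr
      calc |p| ^ 4 = |p ^ 4| := (abs_pow _ _).symm
        _ = |1 + (-(c₂ * p ^ 2 * q ^ 2)) + (-(c₁ * p * q ^ 3)) + (-(c₀ * q ^ 4))| := by
          rw [e]; ring_nf
        _ ≤ |(1 : ℤ)| + |-(c₂ * p ^ 2 * q ^ 2)| + |-(c₁ * p * q ^ 3)| + |-(c₀ * q ^ 4)| := by
          refine (abs_add_le _ _).trans (add_le_add ((abs_add_le _ _).trans
            (add_le_add (abs_add_le _ _) le_rfl)) le_rfl)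
        _ = 1 + |c₂| * (|p| ^ 2 * |q| ^ 2) + |c₁| * (|p| * |q| ^ 3) + |c₀| * |q| ^ 4 := by
          simp only [abs_neg, abs_mul, abs_pow, abs_one]; ring
        _ ≤ m * |p| ^ 3 + |c₂| * (m * |p| ^ 3) + |c₁| * (m * |p| ^ 3) + |c₀| * (m * |p| ^ 3) := by
          gcongr
        _ = _ := by ring
    have h2 : 0 < |p| ^ 3 := by
      have : 0 < |p| := by omega
      positivity
    nlinarith
  by_contra hinf
  have hlarge : ∀ n : ℕ, ∃ v : ℤ × ℕ, n ≤ v.2 ∧ 0 < v.2 ∧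
      v.1 ^ 4 + c₂ * v.1 ^ 2 * v.2 ^ 2 + c₁ * v.1 * v.2 ^ 3 + c₀ * v.2 ^ 4 = 1 := by
    intro n
    by_contra! hno
    apply hinf
    refine Set.Finite.subset (Set.Finite.prod (Set.finite_Icc (-(R * (n + 1))) (R * (n + 1)))
      (Set.finite_Icc (-(n + 1 : ℤ)) (n + 1))) ?_
    rintro ⟨p, q⟩ h
    simp only [Set.mem_ofPred_eq] at h
    have hq : |q| ≤ n + 1 := by
      by_contra! hq
      have hcast : ((q.natAbs : ℕ) : ℤ) = |q| := by simp
      rcases abs_choice q with hs | hs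
      · refine hno (p, q.natAbs) (by omega) (by simp; omega) ?_
        simp only [hcast, hs]
        exact h
      · refine hno (-p, q.natAbs) (by omega) (by simp; omega) ?_
        simp only [hcast, hs]
        linear_combination h
    have hp := hsize p q h
    have hmx : max 1 |q| ≤ n + 1 := max_le (by omega) hq
    have hp2 : |p| ≤ R * (n + 1) := hp.trans (by gcongr)
    exact ⟨abs_le.mp hp2, abs_le.mp hq⟩
  choose v hvn hvpos hv using hlarge
  set t : ℕ → ℝ := fun n => (v n).1 / (v n).2 with ht
  have htmem : ∀ n, t n ∈ Set.Icc (-(R : ℝ)) R := by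
    intro n
    have h1 := hsize (v n).1 (v n).2 (hv n)
    have hpos := hvpos n
    rw [Nat.abs_cast, max_eq_right (by exact_mod_cast hpos)] at h1
    have h2 : |((v n).1 : ℝ)| ≤ R * (v n).2 := by exact_mod_cast h1
    rw [Set.mem_Icc, ← abs_le, ht]
    simp only
    rw [abs_div, Nat.abs_cast, div_le_iff₀ (by exact_mod_cast hpos)]
    exact h2
  obtain ⟨θ, -, φ, hφ, hlim⟩ := isCompact_Icc.tendsto_subseq htmem
  have hqlim : Tendsto (fun n => (((v (φ n)).2 : ℕ) : ℝ)) atTop atTop := by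
    refine tendsto_natCast_atTop_atTop.comp (tendsto_atTop_mono (fun n => ?_) tendsto_id)
    exact (hφ.id_le n).trans (hvn _)
  have hft : ∀ n, t n ^ 4 + c₂ * t n ^ 2 + c₁ * t n + c₀ = 1 / ((v n).2 : ℝ) ^ 4 := by
    intro n
    have hpos : ((v n).2 : ℝ) ≠ 0 := by exact_mod_cast (hvpos n).ne'
    have h2 : ((v n).1 : ℝ) ^ 4 + c₂ * (v n).1 ^ 2 * (v n).2 ^ 2 + c₁ * (v n).1 * (v n).2 ^ 3
      + c₀ * (v n).2 ^ 4 = 1 := by exact_mod_cast hv n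
    simp only [ht]
    field_simp
    linarith
  have hroot : θ ^ 4 + c₂ * θ ^ 2 + c₁ * θ + c₀ = 0 := by
    have l1 : Tendsto (fun n => t (φ n) ^ 4 + c₂ * t (φ n) ^ 2 + c₁ * t (φ n) + c₀) atTop
        (𝓝 (θ ^ 4 + c₂ * θ ^ 2 + c₁ * θ + c₀)) := by
      have hc : Continuous fun s : ℝ => s ^ 4 + c₂ * s ^ 2 + c₁ * s + c₀ := by fun_prop
      exact (hc.tendsto θ).comp hlim
    have l2 : Tendsto (fun n => t (φ n) ^ 4 + c₂ * t (φ n) ^ 2 + c₁ * t (φ n) + c₀) atTop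
        (𝓝 0) := by
      simp only [hft, one_div]
      exact tendsto_inv_atTop_zero.comp ((tendsto_pow_atTop (by norm_num)).comp hqlim)
    exact tendsto_nhds_unique l1 l2
  set h : ℝ → ℝ := fun s => s ^ 3 + s ^ 2 * θ + s * θ ^ 2 + θ ^ 3 + c₂ * (s + θ) + c₁ with hh
  have hθ0 : 0 < |h θ| := by
    rw [abs_pos]
    have := hsep θ hroot
    intro h0
    apply this
    simp only [hh] at h0
    linarith
  obtain ⟨D, hD⟩ := exists_nat_ge (2 / |h θ|)
  obtain ⟨q₀, hq₀⟩ := exists_bound_of_approximation hroot D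
  have ev1 : ∀ᶠ n in atTop, |h θ| / 2 < |h (t (φ n))| := by
    have hc : Continuous fun s => |h s| := by
      simp only [hh]; fun_prop
    exact ((hc.tendsto θ).comp hlim).eventually (lt_mem_nhds (by linarith))
  have ev2 : ∀ᶠ n in atTop, (q₀ : ℝ) ≤ (v (φ n)).2 := hqlim.eventually_ge_atTop _
  obtain ⟨n, hn1, hn2⟩ := (ev1.and ev2).exists
  have hlt := hq₀ (v (φ n)).1 (v (φ n)).2 (hvpos _) (hv _) (by
    have hpos : (0 : ℝ) < ((v (φ n)).2 : ℝ) ^ 4 := by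
      have := hvpos (φ n); positivity
    have e1 : (t (φ n) - θ) * h (t (φ n)) = 1 / ((v (φ n)).2 : ℝ) ^ 4 := by
      rw [← hft]; simp only [hh]; linear_combination -hroot
    have e2 : |t (φ n) - θ| * |h (t (φ n))| = 1 / ((v (φ n)).2 : ℝ) ^ 4 := by
      rw [← abs_mul, e1, abs_of_pos (by positivity)]
    have e3 : (|t (φ n) - θ| * ((v (φ n)).2 : ℝ) ^ 4) * |h (t (φ n))| = 1 := by
      rw [mul_right_comm, e2, one_div_mul_cancel hpos.ne']
    refine le_trans ?_ hD
    rw [le_div_iff₀ hθ0]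
    have : 0 ≤ |t (φ n) - θ| * ((v (φ n)).2 : ℝ) ^ 4 := by positivity
    nlinarith)
  have : (v (φ n)).2 < (v (φ n)).2 := lt_of_lt_of_le hlt (by exact_mod_cast hn2)
  omega

end Thue

/-- The value at `(X, Z)` of the quartic form
`X ^ 4 - 6 * x * X ^ 2 * Z ^ 2 + 8 * y * X * Z ^ 3 - (4 * A + 3 * x ^ 2) * Z ^ 4` attached to a
point `(x, y)` of the curve `y ^ 2 = x ^ 3 + A * x + B`. -/
def mordellForm {R : Type*} [CommRing R] (A x y X Z : R) : R :=
  X ^ 4 - 6 * x * X ^ 2 * Z ^ 2 + 8 * y * X * Z ^ 3 - (4 * A + 3 * x ^ 2) * Z ^ 4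

theorem mordellForm_separable {A B x y θ : ℝ} (hxy : y ^ 2 = x ^ 3 + A * x + B)
    (h0 : θ ^ 4 - 6 * x * θ ^ 2 + 8 * y * θ - (4 * A + 3 * x ^ 2) = 0)
    (h1 : 4 * θ ^ 3 - 12 * x * θ + 8 * y = 0) : 4 * A ^ 3 + 27 * B ^ 2 = 0 := by
  have hy : y = (3 * x * θ - θ ^ 3) / 2 := by linarith
  subst hy
  have hA : A = (θ ^ 4 - 6 * x * θ ^ 2 + 8 * ((3 * x * θ - θ ^ 3) / 2) * θ - 3 * x ^ 2) / 4 := by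
    linarith
  subst hA
  have hB : B = ((3 * x * θ - θ ^ 3) / 2) ^ 2 - x ^ 3 - (θ ^ 4 - 6 * x * θ ^ 2
      + 8 * ((3 * x * θ - θ ^ 3) / 2) * θ - 3 * x ^ 2) / 4 * x := by linarith
  subst hB
  ring

theorem finite_equivalent_mordellForm {A B x₀ y₀ : ℤ} (hAB : 4 * A ^ 3 + 27 * B ^ 2 ≠ 0)
    (h₀ : y₀ ^ 2 = x₀ ^ 3 + A * x₀ + B) :
    {v : ℤ × ℤ | ∃ p q r s : ℤ, p * s - q * r = 1 ∧ ∀ X Z : ℤ,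
      mordellForm A v.1 v.2 X Z = mordellForm A x₀ y₀ (p * X + r * Z) (q * X + s * Z)}.Finite := by
  have hfin := finite_quartic_eq_one (c₂ := -6 * x₀) (c₁ := 8 * y₀) (c₀ := -(4 * A + 3 * x₀ ^ 2))
    (fun θ h0 h1 => hAB (by
      have := mordellForm_separable (A := A) (B := B) (x := x₀) (y := y₀) (θ := θ)
        (by exact_mod_cast h₀) (by push_cast at h0; linarith) (by push_cast at h1; linarith)
      exact_mod_cast this))
  refine (hfin.biUnion (t := fun w => {v : ℤ × ℤ | ∃ r s : ℤ, w.1 * s - w.2 * r = 1 ∧ ∀ X Z : ℤ,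
      mordellForm A v.1 v.2 X Z =
        mordellForm A x₀ y₀ (w.1 * X + r * Z) (w.2 * X + s * Z)}) ?_).subset ?_
  · rintro ⟨p, q⟩ -
    refine Set.Subsingleton.finite ?_
    rintro ⟨x, y⟩ ⟨r, s, hdet, hF⟩ ⟨x', y'⟩ ⟨r', s', hdet', hF'⟩
    simp only at hdet hF hdet' hF'
    set k := (r' - r) * s - (s' - s) * r with hk
    have hr : r' = r + k * p := by
      linear_combination (-(r' - r)) * hdet - r * (hdet - hdet')
    have hs : s' = s + k * q := by
      linear_combination (-(s' - s)) * hdet - s * (hdet - hdet')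
    have key : ∀ X Z : ℤ, mordellForm A x' y' X Z = mordellForm A x y (X + k * Z) Z := by
      intro X Z
      rw [hF', hF, hr, hs]
      congr 1 <;> ring
    have e0 := key 0 1
    have e1 := key 1 1
    have e2 := key (-1) 1
    have e3 := key 2 1
    have e4 := key (-2) 1
    clear_value k
    simp only [mordellForm] at e0 e1 e2 e3 e4
    have hk0 : k = 0 := by linarith
    subst hk0
    ext
    · simp only; linarith
    · simp only; linarith
  · rintro ⟨x, y⟩ ⟨p, q, r, s, hdet, hF⟩
    refine Set.mem_biUnion (x := (p, q)) ?_ ⟨r, s, hdet, hF⟩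
    have := hF 1 0
    simp only [mordellForm] at this
    simp only [Set.mem_ofPred_eq]
    linear_combination -this

theorem exists_reduced_vectors {h : ℝ} (hh : 1 ≤ h) :
    ∃ p q r s : ℤ, p * s - q * r = 1 ∧ 0 < q ∧
      ((h * (p - h ^ 2 * q)) ^ 2 + (q / h) ^ 2) *
        ((h * (r - h ^ 2 * s)) ^ 2 + (s / h) ^ 2) ≤ 2 ∧
      (h * (p - h ^ 2 * q)) ^ 2 + (q / h) ^ 2 ≤ 2 := by
  have hpos : 0 < h := by linarith
  have hn : 0 < ⌊h⌋₊ := Nat.floor_pos.mpr hh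
  obtain ⟨v, hv, hden⟩ := Real.exists_rat_abs_sub_le_and_den_le (h ^ 2) hn
  set p : ℤ := v.num with hp
  set q : ℤ := (v.den : ℤ) with hq
  have hqpos : 0 < q := by have := v.pos; omega
  have hqR : (0 : ℝ) < q := by exact_mod_cast hqpos
  have hvR : (v : ℝ) = p / q := by
    rw [hq, hp, Int.cast_natCast]; exact Rat.cast_def v
  have hfl : h < ⌊h⌋₊ + 1 := Nat.lt_floor_add_one h
  have hU : |h * (p - h ^ 2 * q)| ≤ 1 := by
    have e : h * (p - h ^ 2 * q) = -(h * q * (h ^ 2 - v)) := by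
      rw [hvR]; field_simp; ring
    rw [e, abs_neg, abs_mul, abs_of_pos (by positivity)]
    have hvd : ((v.den : ℕ) : ℝ) = q := by rw [hq]; simp
    rw [hvd] at hv
    calc h * q * |h ^ 2 - v| ≤ h * q * (1 / ((⌊h⌋₊ + 1) * q)) := by gcongr
      _ = h / (⌊h⌋₊ + 1) := by field_simp
      _ ≤ 1 := by rw [div_le_one (by positivity)]; exact hfl.le
  have hW : |(q : ℝ) / h| ≤ 1 := by
    rw [abs_of_pos (by positivity), div_le_one hpos]
    have h1 : (v.den : ℝ) ≤ ⌊h⌋₊ := by exact_mod_cast hden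
    have h2 := Nat.floor_le hpos.le
    rw [hq]; push_cast; linarith
  have hcop : IsCoprime p q := by
    rw [Int.isCoprime_iff_gcd_eq_one, Int.gcd, hq, Int.natAbs_natCast]
    exact v.reduced
  obtain ⟨s₀, r₀, hrs⟩ := hcop
  set u := h * (p - h ^ 2 * q) with hu
  set w := (q : ℝ) / h with hw
  have hwpos : 0 < w := by positivity
  set N := u ^ 2 + w ^ 2 with hN
  have hNpos : 0 < N := by positivity
  have hN2 : N ≤ 2 := by
    have h1 := (sq_le_one_iff_abs_le_one u).mpr hU
    have h2 := (sq_le_one_iff_abs_le_one w).mpr hW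
    linarith
  set k := round ((u * (h * (-r₀ - h ^ 2 * s₀)) + w * (s₀ / h)) / N) with hk
  refine ⟨p, q, -r₀ - k * p, s₀ - k * q, by linear_combination hrs, hqpos, ?_, hN2⟩
  push_cast
  set u' : ℝ := h * (-r₀ - k * p - h ^ 2 * (s₀ - k * q)) with hu'
  set w' : ℝ := (s₀ - k * q) / h with hw'
  have hdet : u * w' - u' * w = 1 := by
    have : (s₀ : ℝ) * p + r₀ * q = 1 := by exact_mod_cast hrs
    rw [hu, hw, hu', hw']
    field_simp
    linear_combination this
  have hin : u * u' + w * w' = N * ((u * (h * (-r₀ - h ^ 2 * s₀)) + w * (s₀ / h)) / N - k) := by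
    rw [mul_sub, mul_div_cancel₀ _ hNpos.ne', hN, hu', hw', hu, hw]
    field_simp
    ring
  have hround := abs_sub_round ((u * (h * (-r₀ - h ^ 2 * s₀)) + w * (s₀ / h)) / N)
  rw [← hk] at hround
  have h1 : |u * u' + w * w'| ≤ 1 := by
    rw [hin, abs_mul, abs_of_pos hNpos]
    nlinarith
  have h2 := (sq_le_one_iff_abs_le_one _).mpr h1
  have h3 : N * (u' ^ 2 + w' ^ 2) = (u * u' + w * w') ^ 2 + (u * w' - u' * w) ^ 2 := by
    rw [hN]; ring
  rw [h3, hdet]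
  linarith

theorem abs_mordell_coeff_le {A B M h y : ℝ} (hh : 1 ≤ h) (hM : |A| + |B| ≤ M) (hy : 0 ≤ y)
    (hxy : y ^ 2 = (h ^ 4) ^ 3 + A * h ^ 4 + B) :
    |8 * (y - h ^ 6) * h ^ 2| ≤ 4 + 8 * M + 4 * M ^ 2 ∧
      |(8 * (y - h ^ 6) * h ^ 2 - 4 * A) * h ^ 4| ≤ 4 + 8 * M + 4 * M ^ 2 := by
  set η := y - h ^ 6 with hη
  have hA := abs_nonneg A
  have hB := abs_nonneg B
  have hM0 : 0 ≤ M := by linarith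
  have hpos : 0 < h := by linarith
  have h4 : 1 ≤ h ^ 4 := one_le_pow₀ hh
  have h2 : 1 ≤ h ^ 2 := one_le_pow₀ hh
  have e1 : η * (y + h ^ 6) = A * h ^ 4 + B := by rw [hη]; linear_combination hxy
  have e2 : (8 * η * h ^ 2 - 4 * A) * (y + h ^ 6) = 8 * B * h ^ 2 - 4 * A * η := by
    linear_combination 8 * h ^ 2 * e1 - 4 * A * hη
  have hsum : h ^ 6 ≤ |y + h ^ 6| := le_trans (by linarith) (le_abs_self _)
  have b1 : |η| * h ^ 2 ≤ M := by
    have : (|η| * h ^ 2) * h ^ 4 ≤ M * h ^ 4 := by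
      calc (|η| * h ^ 2) * h ^ 4 = |η| * h ^ 6 := by ring
        _ ≤ |η| * |y + h ^ 6| := by gcongr
        _ = |A * h ^ 4 + B| := by rw [← abs_mul, e1]
        _ ≤ |A| * h ^ 4 + |B| := by
          refine (abs_add_le _ _).trans ?_
          rw [abs_mul, abs_of_pos (by positivity : 0 < h ^ 4)]
        _ ≤ (|A| + |B|) * h ^ 4 := by nlinarith
        _ ≤ M * h ^ 4 := by gcongr
    exact le_of_mul_le_mul_right this (by positivity)
  have b2 : |η| ≤ M := le_trans (by nlinarith [abs_nonneg η]) b1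
  constructor
  · rw [abs_mul, abs_mul, abs_of_pos (by positivity : 0 < h ^ 2),
      abs_of_pos (by norm_num : (0 : ℝ) < 8)]
    nlinarith
  · have : |(8 * η * h ^ 2 - 4 * A) * h ^ 4| * h ^ 2 ≤ (4 + 8 * M + 4 * M ^ 2) * h ^ 2 := by
      calc |(8 * η * h ^ 2 - 4 * A) * h ^ 4| * h ^ 2 = |8 * η * h ^ 2 - 4 * A| * h ^ 6 := by
            rw [abs_mul, abs_of_pos (by positivity : 0 < h ^ 4)]; ring
        _ ≤ |8 * η * h ^ 2 - 4 * A| * |y + h ^ 6| := by gcongr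
        _ = |8 * B * h ^ 2 - 4 * A * η| := by rw [← abs_mul, e2]
        _ ≤ 8 * |B| * h ^ 2 + 4 * |A| * |η| := by
          refine (abs_sub _ _).trans ?_
          simp only [abs_mul, abs_of_pos (by positivity : 0 < h ^ 2)]
          norm_num
        _ ≤ 8 * M * h ^ 2 + 4 * M * M := by gcongr <;> linarith
        _ ≤ _ := by nlinarith [mul_nonneg hM0 hM0]
    exact le_of_mul_le_mul_right this (by positivity)

theorem abs_mul_four_le {K k x₁ x₂ x₃ x₄ r₁ r₂ r₃ r₄ : ℝ} (hk : |k| ≤ K) (h₁ : |x₁| ≤ r₁)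
    (h₂ : |x₂| ≤ r₂) (h₃ : |x₃| ≤ r₃) (h₄ : |x₄| ≤ r₄) :
    |k * x₁ * x₂ * x₃ * x₄| ≤ K * (r₁ * r₂ * r₃ * r₄) := by
  have hr₁ := (abs_nonneg _).trans h₁
  have hr₂ := (abs_nonneg _).trans h₂
  have hr₃ := (abs_nonneg _).trans h₃
  have hK := (abs_nonneg _).trans hk
  calc |k * x₁ * x₂ * x₃ * x₄| = |k| * |x₁| * |x₂| * |x₃| * |x₄| := by simp only [abs_mul]
    _ ≤ K * r₁ * r₂ * r₃ * r₄ := by gcongr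
    _ = _ := by ring

theorem abs_quartic_coeff_le {K k₀ k₁ k₃ k₄ u u' w w' ρ ρ' : ℝ}
    (h₀ : |k₀| ≤ K) (h₁ : |k₁| ≤ K) (h₃ : |k₃| ≤ K) (h₄ : |k₄| ≤ K)
    (hu : |u| ≤ ρ) (hw : |w| ≤ ρ) (hu' : |u'| ≤ ρ') (hw' : |w'| ≤ ρ') :
    |k₀ * u ^ 4 + k₁ * u ^ 3 * w + k₃ * u * w ^ 3 + k₄ * w ^ 4| ≤ 4 * K * ρ ^ 4 ∧
    |4 * k₀ * u ^ 3 * u' + k₁ * (3 * u ^ 2 * u' * w + u ^ 3 * w') +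
      k₃ * (u' * w ^ 3 + 3 * u * w ^ 2 * w') + 4 * k₄ * w ^ 3 * w'| ≤ 16 * K * (ρ ^ 3 * ρ') ∧
    |6 * k₀ * u ^ 2 * u' ^ 2 + k₁ * (3 * u * u' ^ 2 * w + 3 * u ^ 2 * u' * w') +
      k₃ * (3 * u' * w ^ 2 * w' + 3 * u * w * w' ^ 2) + 6 * k₄ * w ^ 2 * w' ^ 2|
        ≤ 24 * K * (ρ ^ 2 * ρ' ^ 2) := by
  refine ⟨?_, ?_, ?_⟩
  · have t₀ := abs_le.mp (abs_mul_four_le h₀ hu hu hu hu)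
    have t₁ := abs_le.mp (abs_mul_four_le h₁ hu hu hu hw)
    have t₃ := abs_le.mp (abs_mul_four_le h₃ hu hw hw hw)
    have t₄ := abs_le.mp (abs_mul_four_le h₄ hw hw hw hw)
    rw [abs_le]
    constructor <;> nlinarith only [t₀, t₁, t₃, t₄]
  · have t₀ := abs_le.mp (abs_mul_four_le h₀ hu hu hu hu')
    have t₁ := abs_le.mp (abs_mul_four_le h₁ hu hu hu' hw)
    have t₁' := abs_le.mp (abs_mul_four_le h₁ hu hu hu hw')
    have t₃ := abs_le.mp (abs_mul_four_le h₃ hu' hw hw hw)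
    have t₃' := abs_le.mp (abs_mul_four_le h₃ hu hw hw hw')
    have t₄ := abs_le.mp (abs_mul_four_le h₄ hw hw hw hw')
    rw [abs_le]
    constructor <;> nlinarith only [t₀, t₁, t₁', t₃, t₃', t₄]
  · have t₀ := abs_le.mp (abs_mul_four_le h₀ hu hu hu' hu')
    have t₁ := abs_le.mp (abs_mul_four_le h₁ hu hu' hu' hw)
    have t₁' := abs_le.mp (abs_mul_four_le h₁ hu hu hu' hw')
    have t₃ := abs_le.mp (abs_mul_four_le h₃ hu' hw hw hw')
    have t₃' := abs_le.mp (abs_mul_four_le h₃ hu hw hw' hw')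
    have t₄ := abs_le.mp (abs_mul_four_le h₄ hw hw hw' hw')
    rw [abs_le]
    constructor <;> nlinarith only [t₀, t₁, t₁', t₃, t₃', t₄]

/-- The coefficient of `X ^ 4` in `mordellForm A x y (p * X + r * Z) (q * X + s * Z)`.
Exchanging `(p, q)` and `(r, s)` gives the coefficient of `Z ^ 4`. -/
def substCoeff₀ {R : Type*} [CommRing R] (A x y p q : R) : R := mordellForm A x y p q

/-- The coefficient of `X ^ 3 * Z` in `mordellForm A x y (p * X + r * Z) (q * X + s * Z)`.
Exchanging `(p, q)` and `(r, s)` gives the coefficient of `X * Z ^ 3`. -/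
def substCoeff₁ {R : Type*} [CommRing R] (A x y p q r s : R) : R :=
  4 * p ^ 3 * r - 6 * x * (2 * p ^ 2 * q * s + 2 * p * r * q ^ 2)
    + 8 * y * (3 * p * q ^ 2 * s + r * q ^ 3) - (4 * A + 3 * x ^ 2) * (4 * q ^ 3 * s)

/-- The coefficient of `X ^ 2 * Z ^ 2` in
`mordellForm A x y (p * X + r * Z) (q * X + s * Z)`. -/
def substCoeff₂ {R : Type*} [CommRing R] (A x y p q r s : R) : R :=
  6 * p ^ 2 * r ^ 2 - 6 * x * (p ^ 2 * s ^ 2 + 4 * p * r * q * s + r ^ 2 * q ^ 2)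
    + 8 * y * (3 * p * q * s ^ 2 + 3 * r * q ^ 2 * s) - (4 * A + 3 * x ^ 2) * (6 * q ^ 2 * s ^ 2)

theorem mordellForm_subst {R : Type*} [CommRing R] (A x y p q r s X Z : R) :
    mordellForm A x y (p * X + r * Z) (q * X + s * Z) =
      substCoeff₀ A x y p q * X ^ 4 + substCoeff₁ A x y p q r s * X ^ 3 * Z
        + substCoeff₂ A x y p q r s * X ^ 2 * Z ^ 2 + substCoeff₁ A x y r s p q * X * Z ^ 3
        + substCoeff₀ A x y r s * Z ^ 4 := by
  simp only [substCoeff₀, substCoeff₁, substCoeff₂, mordellForm]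
  ring

theorem abs_substCoeff_le {A B M h y p q r s ρ ρ' : ℝ} (hh : 1 ≤ h) (hM : |A| + |B| ≤ M)
    (hy : 0 ≤ y) (hxy : y ^ 2 = (h ^ 4) ^ 3 + A * h ^ 4 + B)
    (hu : |h * (p - h ^ 2 * q)| ≤ ρ) (hw : |q / h| ≤ ρ)
    (hu' : |h * (r - h ^ 2 * s)| ≤ ρ') (hw' : |s / h| ≤ ρ') :
    |substCoeff₀ A (h ^ 4) y p q| ≤ 4 * (4 + 8 * M + 4 * M ^ 2) * ρ ^ 4 ∧
    |substCoeff₁ A (h ^ 4) y p q r s| ≤ 16 * (4 + 8 * M + 4 * M ^ 2) * (ρ ^ 3 * ρ') ∧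
    |substCoeff₂ A (h ^ 4) y p q r s| ≤ 24 * (4 + 8 * M + 4 * M ^ 2) * (ρ ^ 2 * ρ' ^ 2) := by
  have hM0 : 0 ≤ M := by linarith [abs_nonneg A, abs_nonneg B]
  have hpos : 0 < h := by linarith
  obtain ⟨h₃, h₄⟩ := abs_mordell_coeff_le hh hM hy hxy
  have h₀ : |1 / h ^ 4| ≤ 4 + 8 * M + 4 * M ^ 2 := by
    rw [abs_of_pos (by positivity)]
    have : 1 / h ^ 4 ≤ 1 := by
      rw [div_le_one (by positivity)]; exact one_le_pow₀ hh
    nlinarith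
  have h₁ : |(4 : ℝ)| ≤ 4 + 8 * M + 4 * M ^ 2 := by
    rw [abs_of_pos (by norm_num)]; nlinarith
  obtain ⟨a, b, c⟩ := abs_quartic_coeff_le h₀ h₁ h₃ h₄ hu hw hu' hw'
  refine ⟨a.trans_eq' ?_, b.trans_eq' ?_, c.trans_eq' ?_⟩
  · congr 1
    simp only [substCoeff₀, mordellForm]; field_simp; ring
  · congr 1
    simp only [substCoeff₁]; field_simp; ring
  · congr 1
    simp only [substCoeff₂]; field_simp; ring

theorem exists_bounded_subst {A B : ℤ} (hAB : 4 * A ^ 3 + 27 * B ^ 2 ≠ 0) :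
    ∃ K : ℤ, ∀ x y : ℤ, 1 ≤ x → 0 ≤ y → y ^ 2 = x ^ 3 + A * x + B →
      ∃ p q r s : ℤ, p * s - q * r = 1 ∧ |substCoeff₀ A x y p q| ≤ K ∧
        |substCoeff₁ A x y p q r s| ≤ K ∧ |substCoeff₂ A x y p q r s| ≤ K ∧
        |substCoeff₁ A x y r s p q| ≤ K ∧ |substCoeff₀ A x y r s| ≤ K := by
  set M : ℤ := |A| + |B| with hM
  have hM0 : 0 ≤ M := by positivity
  set L : ℤ := 4 + 8 * M + 4 * M ^ 2 with hL
  have hL1 : 1 ≤ L := by nlinarith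
  have hL1R : (1 : ℝ) ≤ L := by exact_mod_cast hL1
  refine ⟨16384 * L ^ 3, fun x y hx hy hxy => ?_⟩
  have hxR : (1 : ℝ) ≤ x := by exact_mod_cast hx
  have hyR : (0 : ℝ) ≤ y := by exact_mod_cast hy
  set h : ℝ := √(√x) with hh
  have hh1 : 1 ≤ h := Real.one_le_sqrt.mpr (Real.one_le_sqrt.mpr hxR)
  have hh4 : h ^ 4 = x := by
    rw [show h ^ 4 = (h ^ 2) ^ 2 by ring, hh, Real.sq_sqrt (by positivity),
      Real.sq_sqrt (by positivity)]
  obtain ⟨p, q, r, s, hdet, hq, hprod, hN2⟩ := exists_reduced_vectors hh1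
  refine ⟨p, q, r, s, hdet, ?_⟩
  set N := (h * (p - h ^ 2 * q)) ^ 2 + (q / h) ^ 2 with hN
  set N' := (h * (r - h ^ 2 * s)) ^ 2 + (s / h) ^ 2 with hN'
  have hN0 : 0 < N := by positivity
  have hN0' : 0 ≤ N' := by positivity
  set ρ := √N with hρ
  set ρ' := √N' with hρ'
  have hρ0 : 0 ≤ ρ := Real.sqrt_nonneg _
  have hρ0' : 0 ≤ ρ' := Real.sqrt_nonneg _
  have hsq : ρ ^ 2 = N := Real.sq_sqrt hN0.le
  have hsq' : ρ' ^ 2 = N' := Real.sq_sqrt hN0'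
  have hu : |h * (p - h ^ 2 * q)| ≤ ρ := Real.abs_le_sqrt (le_add_of_nonneg_right (sq_nonneg _))
  have hw : |q / h| ≤ ρ := Real.abs_le_sqrt (le_add_of_nonneg_left (sq_nonneg _))
  have hu' : |h * (r - h ^ 2 * s)| ≤ ρ' :=
    Real.abs_le_sqrt (le_add_of_nonneg_right (sq_nonneg _))
  have hw' : |s / h| ≤ ρ' :=
    Real.abs_le_sqrt (le_add_of_nonneg_left (sq_nonneg _))
  have hMR : |(A : ℝ)| + |(B : ℝ)| ≤ (M : ℝ) := by rw [hM]; push_cast; exact le_rfl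
  have hxyR : (y : ℝ) ^ 2 = (h ^ 4) ^ 3 + A * h ^ 4 + B := by rw [hh4]; exact_mod_cast hxy
  have hLR : 4 + 8 * (M : ℝ) + 4 * (M : ℝ) ^ 2 = L := by rw [hL]; push_cast; ring
  obtain ⟨ba, bb, bc⟩ := abs_substCoeff_le hh1 hMR hyR hxyR hu hw hu' hw'
  obtain ⟨be, bd, -⟩ := abs_substCoeff_le hh1 hMR hyR hxyR hu' hw' hu hw
  rw [hLR, hh4] at ba bb bc bd be
  clear_value ρ ρ'
  clear_value N N' h L
  have hρρ : ρ * ρ' ≤ 2 := by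
    have : (ρ * ρ') ^ 2 ≤ 2 := by rw [mul_pow, hsq, hsq']; exact hprod
    nlinarith only [this, mul_nonneg hρ0 hρ0']
  have ba' : |substCoeff₀ (A : ℝ) x y p q| ≤ 4 * L * N ^ 2 := by
    rwa [← hsq, ← pow_mul]
  have be' : |substCoeff₀ (A : ℝ) x y r s| ≤ 4 * L * N' ^ 2 := by
    rwa [← hsq', ← pow_mul]
  have bc' : |substCoeff₂ (A : ℝ) x y p q r s| ≤ 48 * L := by
    rw [hsq, hsq'] at bc
    refine bc.trans ?_
    calc 24 * (L : ℝ) * (N * N') ≤ 24 * L * 2 := by gcongr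
      _ = _ := by ring
  have bb' : |substCoeff₁ (A : ℝ) x y p q r s| ≤ 32 * L * N := by
    refine bb.trans ?_
    rw [show ρ ^ 3 * ρ' = ρ ^ 2 * (ρ * ρ') by ring, hsq]
    calc 16 * (L : ℝ) * (N * (ρ * ρ')) ≤ 16 * L * (N * 2) := by gcongr
      _ = _ := by ring
  have bd' : |substCoeff₁ (A : ℝ) x y r s p q| ≤ 32 * L * N' := by
    refine bd.trans ?_
    rw [show ρ' ^ 3 * ρ = ρ' ^ 2 * (ρ * ρ') by ring, hsq']
    calc 16 * (L : ℝ) * (N' * (ρ * ρ')) ≤ 16 * L * (N' * 2) := by gcongr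
      _ = _ := by ring
  have hlow : 1 ≤ 32 * L * N := by
    by_contra! hlt
    exfalso
    have ha : substCoeff₀ A x y p q = 0 := by
      rw [← Int.abs_lt_one_iff]
      have : |substCoeff₀ (A : ℝ) x y p q| < 1 := by nlinarith only [ba', hlt, hN0, hN2, hL1R]
      simp only [substCoeff₀, mordellForm] at this ⊢
      exact_mod_cast this
    have hb : substCoeff₁ A x y p q r s = 0 := by
      rw [← Int.abs_lt_one_iff]
      have : |substCoeff₁ (A : ℝ) x y p q r s| < 1 := by linarith
      simp only [substCoeff₁] at this ⊢
      exact_mod_cast this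
    have haR : substCoeff₀ (A : ℝ) x y p q = 0 := by
      simp only [substCoeff₀, mordellForm] at ha ⊢
      exact_mod_cast ha
    have hbR : substCoeff₁ (A : ℝ) x y p q r s = 0 := by
      simp only [substCoeff₁] at hb ⊢
      exact_mod_cast hb
    have hdetR : (p : ℝ) * s - q * r = 1 := by exact_mod_cast hdet
    have hqR : (q : ℝ) ≠ 0 := by exact_mod_cast hq.ne'
    have hF : 4 * (p : ℝ) ^ 3 - 12 * x * p * q ^ 2 + 8 * y * q ^ 3 = 0 := by
      simp only [substCoeff₀, substCoeff₁, mordellForm] at haR hbR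
      linear_combination (-(4 * (p : ℝ) ^ 3 - 12 * x * p * q ^ 2 + 8 * y * q ^ 3)) * hdetR
        + 4 * s * haR - q * hbR
    have := mordellForm_separable (A := A) (B := B) (x := x) (y := y) (θ := p / q)
      (by exact_mod_cast hxy)
      (by
        simp only [substCoeff₀, mordellForm] at haR
        field_simp
        linear_combination haR)
      (by field_simp; linear_combination hF)
    exact hAB (by exact_mod_cast this)
  have hN'le : N' ≤ 64 * L := by
    calc N' = N' * 1 := by ring
      _ ≤ N' * (32 * L * N) := by gcongr
      _ = 32 * L * (N * N') := by ring
      _ ≤ 32 * L * 2 := by gcongr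
      _ = _ := by ring
  have hL3 : (L : ℝ) ≤ L ^ 3 := le_self_pow₀ hL1R (by norm_num)
  have hL3' : (L : ℝ) ^ 2 ≤ L ^ 3 := pow_le_pow_right₀ hL1R (by norm_num)
  have ca : |substCoeff₀ (A : ℝ) x y p q| ≤ 16384 * L ^ 3 := by
    refine ba'.trans ?_
    calc 4 * (L : ℝ) * N ^ 2 ≤ 4 * (L : ℝ) * (2 : ℝ) ^ 2 := by gcongr
      _ ≤ 16384 * (L : ℝ) ^ 3 := by linarith
  have cb : |substCoeff₁ (A : ℝ) x y p q r s| ≤ 16384 * L ^ 3 := by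
    refine bb'.trans ?_
    calc 32 * (L : ℝ) * N ≤ 32 * L * 2 := by gcongr
      _ ≤ 16384 * (L : ℝ) ^ 3 := by linarith
  have cc : |substCoeff₂ (A : ℝ) x y p q r s| ≤ 16384 * L ^ 3 := bc'.trans (by linarith)
  have cd : |substCoeff₁ (A : ℝ) x y r s p q| ≤ 16384 * L ^ 3 := by
    refine bd'.trans ?_
    calc 32 * (L : ℝ) * N' ≤ 32 * L * (64 * L) := by gcongr
      _ = 2048 * L ^ 2 := by ring
      _ ≤ 16384 * (L : ℝ) ^ 3 := by linarith
  have ce : |substCoeff₀ (A : ℝ) x y r s| ≤ 16384 * L ^ 3 := by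
    refine be'.trans ?_
    calc 4 * (L : ℝ) * N' ^ 2 ≤ 4 * L * (64 * L) ^ 2 := by gcongr
      _ = _ := by ring
  simp only [substCoeff₀, substCoeff₁, substCoeff₂, mordellForm] at ca cb cc cd ce ⊢
  exact ⟨by exact_mod_cast ca, by exact_mod_cast cb, by exact_mod_cast cc,
    by exact_mod_cast cd, by exact_mod_cast ce⟩

theorem mordellForm_comp_inverse {R : Type*} [CommRing R] {A x y x₀ y₀ a b c d e p q r s
    p₀ q₀ r₀ s₀ : R} (hdet : p * s - q * r = 1)
    (h : ∀ X Z : R, mordellForm A x y (p * X + r * Z) (q * X + s * Z) =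
      a * X ^ 4 + b * X ^ 3 * Z + c * X ^ 2 * Z ^ 2 + d * X * Z ^ 3 + e * Z ^ 4)
    (h₀ : ∀ X Z : R, mordellForm A x₀ y₀ (p₀ * X + r₀ * Z) (q₀ * X + s₀ * Z) =
      a * X ^ 4 + b * X ^ 3 * Z + c * X ^ 2 * Z ^ 2 + d * X * Z ^ 3 + e * Z ^ 4) (X Z : R) :
    mordellForm A x y X Z = mordellForm A x₀ y₀
      ((p₀ * s - r₀ * q) * X + (r₀ * p - p₀ * r) * Z)
      ((q₀ * s - s₀ * q) * X + (s₀ * p - q₀ * r) * Z) := by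
  have h1 := h (s * X - r * Z) (p * Z - q * X)
  have h2 := h₀ (s * X - r * Z) (p * Z - q * X)
  rw [← h2] at h1
  convert h1 using 2
  · linear_combination -X * hdet
  · linear_combination -Z * hdet
  · ring
  · ring

theorem finite_mordell_of_pos {A B : ℤ} (hAB : 4 * A ^ 3 + 27 * B ^ 2 ≠ 0) :
    {v : ℤ × ℤ | v.2 ^ 2 = v.1 ^ 3 + A * v.1 + B ∧ 1 ≤ v.1 ∧ 0 ≤ v.2}.Finite := by
  obtain ⟨K, hK⟩ := exists_bounded_subst hAB
  let box : Finset ℤ := Finset.Icc (-K) K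
  have hbox : ∀ z : ℤ, |z| ≤ K → z ∈ box := fun z hz => Finset.mem_Icc.mpr (abs_le.mp hz)
  let cls : ℤ × ℤ × ℤ × ℤ × ℤ → Set (ℤ × ℤ) := fun g =>
    {v | v.2 ^ 2 = v.1 ^ 3 + A * v.1 + B ∧ ∃ p q r s : ℤ, p * s - q * r = 1 ∧ ∀ X Z : ℤ,
      mordellForm A v.1 v.2 (p * X + r * Z) (q * X + s * Z) =
        g.1 * X ^ 4 + g.2.1 * X ^ 3 * Z + g.2.2.1 * X ^ 2 * Z ^ 2 + g.2.2.2.1 * X * Z ^ 3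
          + g.2.2.2.2 * Z ^ 4}
  refine (((box ×ˢ box ×ˢ box ×ˢ box ×ˢ box).finite_toSet).biUnion (t := cls) ?_).subset ?_
  · rintro g -
    rcases (cls g).eq_empty_or_nonempty with h | ⟨⟨x₀, y₀⟩, h₀, p₀, q₀, r₀, s₀, hdet₀, hG₀⟩
    · rw [h]; exact Set.finite_empty
    · refine (finite_equivalent_mordellForm hAB h₀).subset ?_
      rintro ⟨x, y⟩ ⟨-, p, q, r, s, hdet, hG⟩
      refine ⟨p₀ * s - r₀ * q, q₀ * s - s₀ * q, r₀ * p - p₀ * r, s₀ * p - q₀ * r, ?_,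
        mordellForm_comp_inverse hdet hG hG₀⟩
      linear_combination hdet₀ * (p * s - q * r) + hdet
  · rintro ⟨x, y⟩ ⟨hxy, hx, hy⟩
    obtain ⟨p, q, r, s, hdet, ha, hb, hc, hd, he⟩ := hK x y hx hy hxy
    refine Set.mem_biUnion (x := (_, _, _, _, _)) ?_ ⟨hxy, p, q, r, s, hdet, fun X Z =>
      mordellForm_subst A x y p q r s X Z⟩
    simp only [Finset.coe_product, Set.mem_prod, Finset.mem_coe]
    exact ⟨hbox _ ha, hbox _ hb, hbox _ hc, hbox _ hd, hbox _ he⟩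

/-- **Mordell's theorem**: an elliptic curve in short Weierstrass form with integer coefficients
has only finitely many integral points. -/
theorem finite_mordell {A B : ℤ} (hAB : 4 * A ^ 3 + 27 * B ^ 2 ≠ 0) :
    {v : ℤ × ℤ | v.2 ^ 2 = v.1 ^ 3 + A * v.1 + B}.Finite := by
  have hpos := finite_mordell_of_pos hAB
  set m : ℤ := 1 + |A| + |B| with hm
  have hfin : {v : ℤ × ℤ | v.2 ^ 2 = v.1 ^ 3 + A * v.1 + B ∧ -m ≤ v.1 ∧ v.1 ≤ 0}.Finite := by
    refine ((Set.finite_Icc (-m) 0).biUnion (t := fun x => {v : ℤ × ℤ | v.1 = x ∧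
      v.2 ∈ Set.Icc (-|x ^ 3 + A * x + B|) |x ^ 3 + A * x + B|}) ?_).subset ?_
    · intro x _
      refine ((Set.finite_singleton x).prod (Set.finite_Icc (-|x ^ 3 + A * x + B|)
        |x ^ 3 + A * x + B|)).subset ?_
      rintro ⟨_, y⟩ ⟨rfl, hy⟩
      exact ⟨rfl, hy⟩
    · rintro ⟨x, y⟩ ⟨hxy, h1, h2⟩
      refine Set.mem_biUnion (x := x) ⟨h1, h2⟩ ⟨rfl, ?_⟩
      rw [Set.mem_Icc, ← abs_le, ← hxy]
      simp only [abs_pow, sq_abs]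
      rcases eq_or_ne y 0 with rfl | h
      · simp
      · have := Int.one_le_abs h
        nlinarith [sq_abs y]
  refine (hfin.union (hpos.union (hpos.image fun v => (v.1, -v.2)))).subset ?_
  rintro ⟨x, y⟩ hxy
  simp only [Set.mem_ofPred_eq] at hxy
  have hA := neg_abs_le A
  have hA' := le_abs_self A
  have hB := le_abs_self B
  have hlow : -m ≤ x := by
    by_contra! hlt
    have h1 : 0 ≤ x ^ 3 + A * x + B := hxy ▸ sq_nonneg y
    have hx : x ≤ -1 := by have := abs_nonneg A; have := abs_nonneg B; omega
    have h2 : A * x ≤ |A| * (-x) := by nlinarith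
    have h3 : |B| ≤ |B| * (-x) := by nlinarith [abs_nonneg B]
    have h4 : 0 ≤ (-x) * (|A| + |B| - x ^ 2) := by nlinarith
    have h5 : x ^ 2 ≤ |A| + |B| := by nlinarith
    nlinarith
  rcases le_or_gt x 0 with h | h
  · exact Or.inl ⟨hxy, hlow, h⟩
  · rcases le_total 0 y with hy | hy
    · exact Or.inr (Or.inl ⟨hxy, h, hy⟩)
    · exact Or.inr (Or.inr ⟨(x, -y), ⟨by simpa using hxy, h, by simpa using hy⟩, by simp⟩)

theorem partCount_add_self {T : Finset ℕ} {a : ℕ} (ha : a ∈ T) (hpos : 0 < a) (n : ℕ) :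
    partCount T (n + a) = partCount T n + partCount (T.erase a) (n + a) := by
  unfold partCount
  rw [← Finset.card_filter_add_card_filter_not (fun p : Nat.Partition (n + a) => a ∈ p.parts)]
  congr 1
  · refine Finset.card_bij'
      (fun p hp => ⟨p.parts.erase a, fun h => p.parts_pos (Multiset.mem_of_mem_erase h), ?_⟩)
      (fun p _ => ⟨a ::ₘ p.parts, ?_, ?_⟩) ?_ ?_ ?_ ?_
    · have := Multiset.sum_erase (Finset.mem_filter.mp hp).2
      rw [p.parts_sum] at this
      omega
    · intro i hi
      rcases Multiset.mem_cons.mp hi with rfl | h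
      · exact hpos
      · exact p.parts_pos h
    · rw [Multiset.sum_cons, p.parts_sum, add_comm]
    · intro p hp
      simp only [Finset.mem_filter, Finset.mem_univ, true_and] at hp ⊢
      exact fun i hi => hp.1 i (Multiset.mem_of_mem_erase hi)
    · intro p hp
      simp only [Finset.mem_filter, Finset.mem_univ, true_and] at hp ⊢
      refine ⟨fun i hi => ?_, Multiset.mem_cons_self _ _⟩
      rcases Multiset.mem_cons.mp hi with rfl | h
      · exact ha
      · exact hp i h
    · intro p hp
      ext1
      exact Multiset.cons_erase (Finset.mem_filter.mp hp).2
    · intro p hp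
      ext1
      exact Multiset.erase_cons_head _ _
  · congr 1
    ext p
    simp only [Finset.mem_filter, Finset.mem_univ, true_and, Finset.mem_erase]
    constructor
    · exact fun h i hi => ⟨fun e => h.2 (e ▸ hi), h.1 i hi⟩
    · exact fun h => ⟨fun i hi => (h i hi).2, fun hi => (h a hi).1 rfl⟩

theorem partCount_of_lt {T : Finset ℕ} {a n : ℕ} (h : n < a) :
    partCount T n = partCount (T.erase a) n := by
  unfold partCount
  congr 1
  ext p
  simp only [Finset.mem_filter, Finset.mem_univ, true_and, Finset.mem_erase]
  refine forall₂_congr fun i hi => ?_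
  have : i ≤ n := p.le_of_mem_parts hi
  exact ⟨fun hT => ⟨by omega, hT⟩, fun hT => hT.2⟩

theorem two_mul_partCount_one_two_mul_two {b : ℕ} (hb : 2 ≤ b) (m : ℕ) :
    2 * partCount {1, 2, 2 * b} m =
      (m / 2 / b + 1) * (b * (m / 2 / b) + 2 * (m / 2 % b + 1)) := by
  have he : ({1, 2, 2 * b} : Finset ℕ).erase (2 * b) = {1, 2} := by
    ext i; simp only [Finset.mem_erase, Finset.mem_insert, Finset.mem_singleton]; omega
  induction m using Nat.strong_induction_on with
  | _ m ih =>
    rcases lt_or_ge m (2 * b) with h | h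
    · rw [partCount_of_lt h, he, partCount_one_two]
      have hlt : m / 2 < b := by omega
      rw [Nat.div_eq_of_lt hlt, Nat.mod_eq_of_lt hlt]
      ring
    · obtain ⟨k, rfl⟩ := Nat.exists_eq_add_of_le' h
      have h2 : (k + 2 * b) / 2 = k / 2 + b := by omega
      rw [partCount_add_self (by simp) (by omega), he, partCount_one_two, mul_add,
        ih k (by omega), h2, Nat.add_div_right _ (by omega), Nat.add_mod_right]
      have := Nat.div_add_mod (k / 2) b
      generalize k / 2 / b = q at *
      generalize k / 2 % b = r at *
      rw [← this]
      ring

theorem partCount_one_two_three_add_three (n : ℕ) :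
    partCount {1, 2, 3} (n + 3) = partCount {1, 2, 3} n + (n + 3) / 2 + 1 := by
  rw [partCount_add_self (by simp) three_pos,
    show ({1, 2, 3} : Finset ℕ).erase 3 = {1, 2} by decide,
    partCount_one_two, add_assoc]

theorem partCount_one_two_three_add_six (n : ℕ) :
    partCount {1, 2, 3} (n + 6) = partCount {1, 2, 3} n + n + 6 := by
  have h1 := partCount_one_two_three_add_three n
  have h2 := partCount_one_two_three_add_three (n + 3)
  rw [show n + 3 + 3 = n + 6 by ring] at h2
  omega

theorem partCount_four_add_four (n : ℕ) :
    partCount {1, 2, 3, 4} (n + 4) = partCount {1, 2, 3, 4} n + partCount {1, 2, 3} (n + 4) := by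
  rw [partCount_add_self (by simp) four_pos,
    show ({1, 2, 3, 4} : Finset ℕ).erase 4 = {1, 2, 3} by decide]

theorem partCount_four_of_lt {n : ℕ} (h : n < 4) :
    partCount {1, 2, 3, 4} n = partCount {1, 2, 3} n := by
  rw [partCount_of_lt h, show ({1, 2, 3, 4} : Finset ℕ).erase 4 = {1, 2, 3} by decide]

theorem four_mul_sum_partCount_one_two_three (n : ℕ) :
    4 * (partCount {1, 2, 3} n + partCount {1, 2, 3} (n + 2) + partCount {1, 2, 3} (n + 4)) =
      (n + 5) ^ 2 + 3 * (1 - n % 2) := by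
  have h0 := partCount_one_two_three_of_lt (n := 0) (by norm_num)
  have h1 := partCount_one_two_three_of_lt (n := 1) (by norm_num)
  have h2 := partCount_one_two_three_of_lt (n := 2) (by norm_num)
  have h3 := partCount_one_two_three_add_three 0
  have h4 := partCount_one_two_three_add_three 1
  have h5 := partCount_one_two_three_add_three 2
  induction n using Nat.twoStepInduction with
  | zero => simp only [Nat.reduceAdd, Nat.reduceDiv] at *; omega
  | one => simp only [Nat.reduceAdd, Nat.reduceDiv] at *; omega
  | more n ih _ =>
    rw [add_assoc n 2 2, add_assoc n 2 4, partCount_one_two_three_add_six, Nat.add_mod_right]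
    linarith

theorem partCount_four_add_twelve (n : ℕ) :
    4 * partCount {1, 2, 3, 4} (n + 12) =
      4 * partCount {1, 2, 3, 4} n + (n + 5) ^ 2 + 3 * (1 - n % 2) + 12 * n + 104 := by
  have h1 := partCount_four_add_four n
  have h2 := partCount_four_add_four (n + 4)
  have h3 := partCount_four_add_four (n + 8)
  have h4 := partCount_one_two_three_add_six (n + 2)
  have h5 := partCount_one_two_three_add_six n
  have h6 := partCount_one_two_three_add_six (n + 6)
  have h7 := four_mul_sum_partCount_one_two_three n
  simp only [add_assoc, Nat.reduceAdd] at *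
  omega

theorem exists_partCount_four_of_even {n : ℕ} (hn : n % 2 = 0) :
    ∃ d : ℤ, |d| ≤ 34 ∧ d % 4 = 2 ∧
      144 * (partCount {1, 2, 3, 4} n : ℤ) = (n + 5) ^ 3 - 3 * (n + 5) + d := by
  induction n using Nat.strong_induction_on with
  | _ n ih =>
    rcases lt_or_ge n 12 with h | h
    · refine ⟨144 * (partCount {1, 2, 3, 4} n : ℤ) - ((n + 5) ^ 3 - 3 * (n + 5)), ?_, ?_, by ring⟩
      all_goals
        have a0 := partCount_one_two_three_of_lt (n := 0) (by norm_num)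
        have a1 := partCount_one_two_three_of_lt (n := 1) (by norm_num)
        have a2 := partCount_one_two_three_of_lt (n := 2) (by norm_num)
        have a4 := partCount_one_two_three_add_three 1
        have a6 := partCount_one_two_three_add_six 0
        have a8 := partCount_one_two_three_add_six 2
        have a10 := partCount_one_two_three_add_six 4
        have b0 := partCount_four_of_lt (n := 0) (by norm_num)
        have b2 := partCount_four_of_lt (n := 2) (by norm_num)
        have b4 := partCount_four_add_four 0
        have b6 := partCount_four_add_four 2
        have b8 := partCount_four_add_four 4
        have b10 := partCount_four_add_four 6
        simp only [Nat.reduceAdd, Nat.reduceDiv] at *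
        interval_cases n <;> first | omega | (push_cast; rw [abs_le]; omega)
    · obtain ⟨k, rfl⟩ := Nat.exists_eq_add_of_le' h
      obtain ⟨d, hd, hd4, hk⟩ := ih k (by omega) (by omega)
      refine ⟨d, hd, hd4, ?_⟩
      have hs := partCount_four_add_twelve k
      rw [show k % 2 = 0 by omega] at hs
      zify at hs
      push_cast
      linear_combination 36 * hs + hk

theorem exists_partCount_four_of_odd {n : ℕ} (hn : n % 2 = 1) :
    ∃ d : ℤ, |d| ≤ 16 ∧ d % 8 = 0 ∧
      144 * (partCount {1, 2, 3, 4} n : ℤ) = (n + 5) ^ 3 - 12 * (n + 5) + d := by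
  induction n using Nat.strong_induction_on with
  | _ n ih =>
    rcases lt_or_ge n 12 with h | h
    · refine ⟨144 * (partCount {1, 2, 3, 4} n : ℤ) - ((n + 5) ^ 3 - 12 * (n + 5)), ?_, ?_, by ring⟩
      all_goals
        have a1 := partCount_one_two_three_of_lt (n := 1) (by norm_num)
        have a0 := partCount_one_two_three_of_lt (n := 0) (by norm_num)
        have a2 := partCount_one_two_three_of_lt (n := 2) (by norm_num)
        have a3 := partCount_one_two_three_add_three 0
        have a5 := partCount_one_two_three_add_three 2
        have a7 := partCount_one_two_three_add_six 1
        have a9 := partCount_one_two_three_add_six 3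
        have a11 := partCount_one_two_three_add_six 5
        have b1 := partCount_four_of_lt (n := 1) (by norm_num)
        have b3 := partCount_four_of_lt (n := 3) (by norm_num)
        have b5 := partCount_four_add_four 1
        have b7 := partCount_four_add_four 3
        have b9 := partCount_four_add_four 5
        have b11 := partCount_four_add_four 7
        simp only [Nat.reduceAdd, Nat.reduceDiv] at *
        interval_cases n <;> first | omega | (push_cast; rw [abs_le]; omega)
    · obtain ⟨k, rfl⟩ := Nat.exists_eq_add_of_le' h
      obtain ⟨d, hd, hd4, hk⟩ := ih k (by omega) (by omega)
      refine ⟨d, hd, hd4, ?_⟩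
      have hs := partCount_four_add_twelve k
      rw [show k % 2 = 1 by omega] at hs
      zify at hs
      push_cast
      linear_combination 36 * hs + hk

theorem exists_eight_mul_partCount {b : ℕ} (hb : 2 ≤ b) (hodd : b % 2 = 1) (m : ℕ) :
    ∃ t : ℤ, |t| ≤ b ∧ t % 2 = 1 ∧
      8 * (b : ℤ) * partCount {1, 2, 2 * b} m = (2 * ((m / 2 : ℕ) : ℤ) + 2 + b) ^ 2 - t ^ 2 := by
  have h := two_mul_partCount_one_two_mul_two hb m
  have hk := Nat.div_add_mod (m / 2) b
  have hr := Nat.mod_lt (m / 2) (by omega : b > 0)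
  set k := m / 2
  set q := k / b
  set r := k % b
  refine ⟨2 * (r + 1) - b, by rw [abs_le]; omega, by omega, ?_⟩
  zify at h hk
  rw [← hk]
  linear_combination 4 * (b : ℤ) * h

theorem discriminant_ne_zero_of_mod_four {b d t : ℤ} (hb : b % 2 = 1) (hd : d % 4 = 2)
    (ht : t % 2 = 1) :
    4 * (4 * b ^ 2 * -3) ^ 3 + 27 * (8 * b ^ 3 * d + 144 * b ^ 2 * t ^ 2) ^ 2 ≠ 0 := by
  intro h
  obtain ⟨b', rfl⟩ : ∃ b', b = 2 * b' + 1 := ⟨b / 2, by omega⟩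
  obtain ⟨d', rfl⟩ : ∃ d', d = 4 * d' + 2 := ⟨d / 4, by omega⟩
  obtain ⟨t', rfl⟩ : ∃ t', t = 2 * t' + 1 := ⟨t / 2, by omega⟩
  have h1 : 1728 * (2 * b' + 1) ^ 4 * (((2 * b' + 1) * (4 * d' + 2) + 18 * (2 * t' + 1) ^ 2) ^ 2
      - 4 * (2 * b' + 1) ^ 2) = 0 := by linear_combination h
  have hb0 : (2 * b' + 1) ≠ 0 := by omega
  have h2 : ((2 * b' + 1) * (4 * d' + 2) + 18 * (2 * t' + 1) ^ 2) ^ 2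
      - 4 * (2 * b' + 1) ^ 2 = 0 := by
    simpa [hb0] using h1
  have h3 : ∃ z : ℤ, ((2 * b' + 1) * (4 * d' + 2) + 18 * (2 * t' + 1) ^ 2) ^ 2
      - 4 * (2 * b' + 1) ^ 2 = 16 * z - 4 :=
    ⟨((2 * b' + 1) * d' + b' + 18 * (t' ^ 2 + t') + 5) ^ 2 - (b' ^ 2 + b'), by ring⟩
  obtain ⟨z, hz⟩ := h3
  omega

theorem discriminant_ne_zero_of_mod_eight {b d t : ℤ} (hb : b % 2 = 1) (hd : d % 8 = 0)
    (ht : t % 2 = 1) :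
    4 * (4 * b ^ 2 * -12) ^ 3 + 27 * (8 * b ^ 3 * d + 144 * b ^ 2 * t ^ 2) ^ 2 ≠ 0 := by
  intro h
  obtain ⟨b', rfl⟩ : ∃ b', b = 2 * b' + 1 := ⟨b / 2, by omega⟩
  obtain ⟨d', rfl⟩ : ∃ d', d = 8 * d' := ⟨d / 8, by omega⟩
  obtain ⟨t', rfl⟩ : ∃ t', t = 2 * t' + 1 := ⟨t / 2, by omega⟩
  have h1 : 1728 * (2 * b' + 1) ^ 4 * (((2 * b' + 1) * (8 * d') + 18 * (2 * t' + 1) ^ 2) ^ 2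
      - 256 * (2 * b' + 1) ^ 2) = 0 := by linear_combination h
  have hb0 : (2 * b' + 1) ≠ 0 := by omega
  have h2 : ((2 * b' + 1) * (8 * d') + 18 * (2 * t' + 1) ^ 2) ^ 2
      - 256 * (2 * b' + 1) ^ 2 = 0 := by
    simpa [hb0] using h1
  have h3 : ∃ z : ℤ, ((2 * b' + 1) * (8 * d') + 18 * (2 * t' + 1) ^ 2) ^ 2
      - 256 * (2 * b' + 1) ^ 2 = 16 * z + 4 :=
    ⟨((2 * b' + 1) * (2 * d') + 18 * (t' ^ 2 + t') + 4) ^ 2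
      + ((2 * b' + 1) * (2 * d') + 18 * (t' ^ 2 + t') + 4) - 16 * (2 * b' + 1) ^ 2, by ring⟩
  obtain ⟨z, hz⟩ := h3
  omega

theorem stmt14 (a : ℕ) (ha : 3 ≤ a) (hmod : a % 4 = 2) :
    {mn : ℕ × ℕ |
      partCount {1, 2, a} mn.1 = partCount {1, 2, 3, 4} mn.2}.Finite := by
  obtain ⟨b, rfl⟩ : ∃ b, a = 2 * b := ⟨a / 2, by omega⟩
  have hb : 2 ≤ b := by omega
  have hodd : b % 2 = 1 := by omega
  let I : Set (ℤ × ℤ × ℤ) := {i | i ∈ Set.Icc (-(b : ℤ)) b ×ˢ Set.Icc (-34 : ℤ) 34 ×ˢ {-3, -12} ∧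
    4 * (4 * (b : ℤ) ^ 2 * i.2.2) ^ 3
      + 27 * (8 * (b : ℤ) ^ 3 * i.2.1 + 144 * (b : ℤ) ^ 2 * i.1 ^ 2) ^ 2 ≠ 0}
  have hI : I.Finite :=
    ((Set.finite_Icc _ _).prod ((Set.finite_Icc _ _).prod (Set.toFinite _))).subset
      fun _ hi => hi.1
  let E : ℤ × ℤ × ℤ → Set (ℤ × ℤ) := fun i => {v | v.2 ^ 2 = v.1 ^ 3 + 4 * (b : ℤ) ^ 2 * i.2.2 * v.1
    + (8 * (b : ℤ) ^ 3 * i.2.1 + 144 * (b : ℤ) ^ 2 * i.1 ^ 2)}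
  have hE : (⋃ i ∈ I, E i).Finite := hI.biUnion fun i hi => finite_mordell hi.2
  let f : ℕ × ℕ → ℕ × ℤ × ℤ := fun v =>
    (v.1 % 2, 2 * b * (v.2 + 5), 12 * b * (2 * ((v.1 / 2 : ℕ) : ℤ) + 2 + b))
  have hf : Function.Injective f := by
    rintro ⟨m, n⟩ ⟨m', n'⟩ h
    simp only [f, Prod.mk.injEq] at h
    obtain ⟨h1, h2, h3⟩ := h
    have hb0 : (b : ℤ) ≠ 0 := by omega
    have h2' := mul_left_cancel₀ (by simpa using hb0) h2
    have h3' := mul_left_cancel₀ (by simpa using hb0) h3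
    rw [Prod.mk.injEq]
    omega
  refine (((Set.finite_Icc 0 1).prod hE).preimage hf.injOn).subset ?_
  rintro ⟨m, n⟩ hmn
  simp only [Set.mem_ofPred_eq] at hmn
  obtain ⟨t, ht, ht2, hY⟩ := exists_eight_mul_partCount hb hodd m
  refine ⟨Set.mem_Icc.mpr ⟨Nat.zero_le _, by simp only [f]; omega⟩, ?_⟩
  rw [hmn] at hY
  have hbz : (b : ℤ) % 2 = 1 := by omega
  rcases Nat.mod_two_eq_zero_or_one n with hn | hn
  · obtain ⟨d, hd, hd4, hP⟩ := exists_partCount_four_of_even hn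
    refine Set.mem_biUnion (x := (t, d, -3)) ⟨⟨abs_le.mp ht, abs_le.mp hd, by simp⟩,
      discriminant_ne_zero_of_mod_four hbz hd4 ht2⟩ ?_
    simp only [E, f, Set.mem_ofPred_eq]
    linear_combination -144 * (b : ℤ) ^ 2 * hY + 8 * (b : ℤ) ^ 3 * hP
  · obtain ⟨d, hd, hd8, hP⟩ := exists_partCount_four_of_odd hn
    refine Set.mem_biUnion (x := (t, d, -12)) ⟨⟨abs_le.mp ht, abs_le.mp (hd.trans (by norm_num)),
      by simp⟩, discriminant_ne_zero_of_mod_eight hbz hd8 ht2⟩ ?_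
    simp only [E, f, Set.mem_ofPred_eq]
    linear_combination -144 * (b : ℤ) ^ 2 * hY + 8 * (b : ℤ) ^ 3 * hP
end
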